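/- arXiv:1809.06819 — 6 statements merged into one kernel-verified Lean document; each statement's English description precedes it below -/
import Mathlib

section
/- If X and Y are λ-sets, then the product space X × Y is a λ-set. -/
open Set TopologicalSpace

/-- A space is zero-dimensional if it has a basis of clopen sets. -/
def ZeroDimensional (X : Type*) [TopologicalSpace X] : Prop :=
  ∃ B : Set (Set X), IsTopologicalBasis B ∧ ∀ s ∈ B, IsClopen s

/-- A λ-set (as a space): a zero-dimensional separable metrizable space in which
every countable subset is a (relative) Gδ-set. -/
def IsLambdaSpace (X : Type*) [TopologicalSpace X] : Prop :=
  ZeroDimensional X ∧ SeparableSpace X ∧ MetrizableSpace X ∧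
    ∀ A : Set X, A.Countable → IsGδ A

theorem ZeroDimensional.prod {X Y : Type*} [TopologicalSpace X] [TopologicalSpace Y]
    (hX : ZeroDimensional X) (hY : ZeroDimensional Y) : ZeroDimensional (X × Y) := by
  obtain ⟨B, hB, cB⟩ := hX
  obtain ⟨C, hC, cC⟩ := hY
  refine ⟨_, hB.prod hC, ?_⟩
  rintro _ ⟨s, hs, t, ht, rfl⟩
  exact (cB s hs).prod (cC t ht)

theorem product_of_lambda_sets (X Y : Type*) [TopologicalSpace X] [TopologicalSpace Y]
    (hX : IsLambdaSpace X) (hY : IsLambdaSpace Y) : IsLambdaSpace (X × Y) := by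
  obtain ⟨zX, _, _, gX⟩ := hX
  obtain ⟨zY, _, _, gY⟩ := hY
  refine ⟨zX.prod zY, inferInstance, inferInstance, fun A hA => ?_⟩
  have hR : ((Prod.fst '' A) ×ˢ (Prod.snd '' A)).Countable := (hA.image _).prod (hA.image _)
  have hG : IsGδ ((Prod.fst '' A) ×ˢ (Prod.snd '' A)) := by
    rw [prod_eq]
    exact ((gX _ (hA.image Prod.fst)).preimage continuous_fst).inter
      ((gY _ (hA.image Prod.snd)).preimage continuous_snd)
  have hsub : A ⊆ (Prod.fst '' A) ×ˢ (Prod.snd '' A) := fun p hp =>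
    ⟨mem_image_of_mem _ hp, mem_image_of_mem _ hp⟩
  have hdiff := hG.inter (hR.mono (sdiff_subset (t := A))).isGδ_compl
  rwa [← sdiff_eq, sdiff_sdiff_cancel_left hsub] at hdiff
end

section
/- If a separable metrizable space X has a countable cover by closed subspaces each of which is a λ-set, then X is itself a λ-set (in particular X is zero-dimensional and every countable subset of X is a relative G_δ-set). -/
open Set TopologicalSpace

/-- In a second-countable zero-dimensional space, disjoint closed sets are separated by a
clopen set. -/
theorem ZeroDimensional.exists_isClopen_separating {Y : Type*} [TopologicalSpace Y]
    [SecondCountableTopology Y] (hY : ZeroDimensional Y) {K L : Set Y} (hK : IsClosed K)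
    (hL : IsClosed L) (hKL : Disjoint K L) :
    ∃ W : Set Y, IsClopen W ∧ K ⊆ W ∧ Disjoint W L := by
  obtain ⟨B, hB, hBc⟩ := hY
  have hloc : ∀ y : Y, ∃ s : Set Y, IsClopen s ∧ y ∈ s ∧ (Disjoint s K ∨ Disjoint s L) := by
    intro y
    by_cases hy : y ∈ K
    · obtain ⟨s, hs, hys, hsL⟩ := hB.exists_subset_of_mem_open
        (show y ∈ Lᶜ from hKL.notMem_of_mem_left hy) hL.isOpen_compl
      exact ⟨s, hBc s hs, hys, Or.inr (disjoint_left.2 hsL)⟩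
    · obtain ⟨s, hs, hys, hsK⟩ := hB.exists_subset_of_mem_open
        (show y ∈ Kᶜ from hy) hK.isOpen_compl
      exact ⟨s, hBc s hs, hys, Or.inl (disjoint_left.2 hsK)⟩
  choose f hfc hyf hf using hloc
  obtain ⟨S, hS, hSU⟩ := TopologicalSpace.countable_cover_nhds fun y => (hfc y).isOpen.mem_nhds (hyf y)
  rcases S.eq_empty_or_nonempty with rfl | hne
  · have hempty : (univ : Set Y) = ∅ := by simpa using hSU.symm
    have hKe : K ⊆ ∅ := hempty ▸ subset_univ K
    exact ⟨∅, isClopen_empty, hKe, empty_disjoint L⟩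
  obtain ⟨g, rfl⟩ := hS.exists_eq_range hne
  let s : ℕ → Set Y := fun n => f (g n)
  have hsU : ⋃ n, s n = univ := by simpa using hSU
  have htU : ⋃ n, disjointed s n = univ := by rw [iUnion_disjointed, hsU]
  have ht : ∀ n, IsOpen (disjointed s n) := fun n =>
    (disjointedRec (p := IsClopen) (fun _ i h => h.diff (hfc (g i))) (hfc (g n))).isOpen
  have hcover : ∀ y, ∃ n, y ∈ disjointed s n := fun y =>
    mem_iUnion.1 (htU.symm ▸ mem_univ y)
  refine ⟨⋃ n ∈ {n | Disjoint (s n) L}, disjointed s n, ⟨?_, ?_⟩, ?_, ?_⟩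
  · have hcompl : (⋃ n ∈ {n | Disjoint (s n) L}, disjointed s n)ᶜ =
        ⋃ n ∈ {n | ¬ Disjoint (s n) L}, disjointed s n := by
      ext y
      simp only [mem_compl_iff, mem_iUnion, mem_ofPred_eq, not_exists]
      constructor
      · intro h
        obtain ⟨n, hn⟩ := hcover y
        exact ⟨n, fun hd => h n hd hn, hn⟩
      · rintro ⟨n, hd, hn⟩ m hm hym
        have hmn : m ≠ n := by
          rintro rfl
          exact hd hm
        exact disjoint_left.1 (disjoint_disjointed s hmn) hym hn
    rw [← isOpen_compl_iff, hcompl]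
    exact isOpen_biUnion fun n _ => ht n
  · exact isOpen_biUnion fun n _ => ht n
  · intro y hy
    obtain ⟨n, hn⟩ := hcover y
    have hys : y ∈ s n := disjointed_le s n hn
    have hd : Disjoint (s n) L :=
      (hf (g n)).resolve_left fun h => disjoint_left.1 h hys hy
    exact mem_biUnion (show n ∈ {n | Disjoint (s n) L} from hd) hn
  · simp only [disjoint_iUnion_left]
    exact fun n hn => hn.mono_left (disjointed_le s n)

/-- Disjoint closed sets can be enlarged to disjoint closed neighbourhoods covering a given
closed zero-dimensional subspace. -/
theorem exists_closed_nhds_covering {X : Type*} [TopologicalSpace X]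
    [SecondCountableTopology X] [NormalSpace X] {c : Set X} (hc : IsClosed c)
    (hz : ZeroDimensional c) {P Q : Set X} (hP : IsClosed P) (hQ : IsClosed Q)
    (hPQ : Disjoint P Q) :
    ∃ P' Q' : Set X, (IsClosed P' ∧ IsClosed Q' ∧ Disjoint P' Q') ∧
      P ⊆ interior P' ∧ Q ⊆ interior Q' ∧ c ⊆ P' ∪ Q' := by
  obtain ⟨W, hW, hPW, hWQ⟩ := hz.exists_isClopen_separating
    (hP.preimage continuous_subtype_val) (hQ.preimage continuous_subtype_val)
    (hPQ.preimage _)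
  have hW1 : IsClosed ((↑) '' W : Set X) := hc.isClosedEmbedding_subtypeVal.isClosedMap _ hW.1
  have hW2 : IsClosed ((↑) '' Wᶜ : Set X) :=
    hc.isClosedEmbedding_subtypeVal.isClosedMap _ hW.compl.1
  have hdisj : P ∪ (↑) '' W ⊆ (Q ∪ (↑) '' Wᶜ)ᶜ := by
    rintro x (hx | ⟨y, hy, rfl⟩) (hx' | ⟨z, hz, hzx⟩)
    · exact disjoint_left.1 hPQ hx hx'
    · exact hz (hPW (show (z : X) ∈ P from hzx ▸ hx))
    · exact disjoint_left.1 hWQ hy hx'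
    · exact hz (Subtype.ext hzx ▸ hy)
  obtain ⟨u, hu, hPu, huQ⟩ := normal_exists_closure_subset (hP.union hW1)
    (hQ.union hW2).isOpen_compl hdisj
  obtain ⟨v, hv, hQv, hvu⟩ := normal_exists_closure_subset (hQ.union hW2)
    isClosed_closure.isOpen_compl (subset_compl_comm.1 huQ)
  refine ⟨closure u, closure v, ⟨isClosed_closure, isClosed_closure,
    (disjoint_left.2 hvu).symm⟩, ?_, ?_, ?_⟩
  · exact (subset_union_left.trans hPu).trans (interior_maximal subset_closure hu)
  · exact (subset_union_left.trans hQv).trans (interior_maximal subset_closure hv)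
  · intro x hx
    by_cases h : (⟨x, hx⟩ : c) ∈ W
    · exact Or.inl (subset_closure (hPu (Or.inr ⟨_, h, rfl⟩)))
    · exact Or.inr (subset_closure (hQv (Or.inr ⟨_, h, rfl⟩)))

/-- In a second-countable normal space covered by a sequence of closed zero-dimensional
subspaces, disjoint closed sets are separated by a clopen set. -/
theorem exists_isClopen_separating_of_closed_cover {X : Type*} [TopologicalSpace X]
    [SecondCountableTopology X] [NormalSpace X] {c : ℕ → Set X} (hc : ∀ n, IsClosed (c n))
    (hz : ∀ n, ZeroDimensional (c n)) (hcov : ⋃ n, c n = univ) {K L : Set X}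
    (hK : IsClosed K) (hL : IsClosed L) (hKL : Disjoint K L) :
    ∃ U : Set X, IsClopen U ∧ K ⊆ U ∧ Disjoint U L := by
  let T := {p : Set X × Set X // IsClosed p.1 ∧ IsClosed p.2 ∧ Disjoint p.1 p.2}
  have hstep : ∀ (n : ℕ) (p : T), ∃ q : T, p.1.1 ⊆ interior q.1.1 ∧
      p.1.2 ⊆ interior q.1.2 ∧ c n ⊆ q.1.1 ∪ q.1.2 := by
    rintro n ⟨⟨P, Q⟩, hP, hQ, hPQ⟩
    obtain ⟨P', Q', h, h'⟩ := exists_closed_nhds_covering (hc n) (hz n) hP hQ hPQ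
    exact ⟨⟨(P', Q'), h⟩, h'⟩
  choose F hF1 hF2 hF3 using hstep
  let p : ℕ → T := fun n => Nat.rec ⟨(K, L), hK, hL, hKL⟩ F n
  have h1 : ∀ n, (p n).1.1 ⊆ interior (p (n + 1)).1.1 := fun n => hF1 n (p n)
  have h2 : ∀ n, (p n).1.2 ⊆ interior (p (n + 1)).1.2 := fun n => hF2 n (p n)
  have h3 : ∀ n, c n ⊆ (p (n + 1)).1.1 ∪ (p (n + 1)).1.2 := fun n => hF3 n (p n)
  have hm1 : Monotone fun n => (p n).1.1 :=
    monotone_nat_of_le_succ fun n => (h1 n).trans interior_subset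
  have hm2 : Monotone fun n => (p n).1.2 :=
    monotone_nat_of_le_succ fun n => (h2 n).trans interior_subset
  have ho1 : IsOpen (⋃ n, (p n).1.1) := isOpen_iff_mem_nhds.2 fun x hx => by
    obtain ⟨n, hn⟩ := mem_iUnion.1 hx
    exact Filter.mem_of_superset (mem_interior_iff_mem_nhds.1 (h1 n hn))
      (subset_iUnion (fun n => (p n).1.1) (n + 1))
  have ho2 : IsOpen (⋃ n, (p n).1.2) := isOpen_iff_mem_nhds.2 fun x hx => by
    obtain ⟨n, hn⟩ := mem_iUnion.1 hx
    exact Filter.mem_of_superset (mem_interior_iff_mem_nhds.1 (h2 n hn))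
      (subset_iUnion (fun n => (p n).1.2) (n + 1))
  have hdisj : Disjoint (⋃ n, (p n).1.1) (⋃ n, (p n).1.2) := by
    simp only [disjoint_iUnion_left, disjoint_iUnion_right]
    exact fun i j =>
      (p (max j i)).2.2.2.mono (hm1 (le_max_left j i)) (hm2 (le_max_right j i))
  have hcompl : (⋃ n, (p n).1.1)ᶜ = ⋃ n, (p n).1.2 := by
    refine Subset.antisymm (fun x hx => ?_) hdisj.subset_compl_left
    obtain ⟨n, hn⟩ := mem_iUnion.1 (hcov.symm ▸ mem_univ x)
    rcases h3 n hn with h | h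
    · exact absurd (mem_iUnion.2 ⟨n + 1, h⟩) hx
    · exact mem_iUnion.2 ⟨n + 1, h⟩
  refine ⟨⋃ n, (p n).1.1, ⟨?_, ho1⟩, subset_iUnion (fun n => (p n).1.1) 0,
    hdisj.mono_right (subset_iUnion (fun n => (p n).1.2) 0)⟩
  rw [← isOpen_compl_iff, hcompl]
  exact ho2

/-- The countable closed sum theorem in dimension zero. -/
theorem zeroDimensional_of_closed_cover {X : Type*} [TopologicalSpace X]
    [SecondCountableTopology X] [T4Space X] {c : ℕ → Set X} (hc : ∀ n, IsClosed (c n))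
    (hz : ∀ n, ZeroDimensional (c n)) (hcov : ⋃ n, c n = univ) : ZeroDimensional X := by
  refine ⟨{s | IsClopen s}, isTopologicalBasis_of_isOpen_of_nhds (fun s hs => hs.isOpen) ?_,
    fun s hs => hs⟩
  intro x U hx hU
  obtain ⟨W, hW, hxW, hWU⟩ := exists_isClopen_separating_of_closed_cover hc hz hcov
    (isClosed_singleton (x := x)) hU.isClosed_compl (by simpa using hx)
  exact ⟨W, hW, hxW rfl, disjoint_compl_right_iff_subset.1 hWU⟩

/-- A relative Gδ-set of a subspace is the trace of a Gδ-set. -/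
theorem IsGδ.exists_preimage_subtype_val_eq {X : Type*} [TopologicalSpace X] {c : Set X}
    {A : Set c} (hA : IsGδ A) : ∃ G : Set X, IsGδ G ∧ (↑) ⁻¹' G = A := by
  obtain ⟨V, hV, rfl⟩ := isGδ_iff_eq_iInter_nat.1 hA
  choose O hO hOV using fun n => isOpen_induced_iff.1 (hV n)
  exact ⟨⋂ n, O n, .iInter_of_isOpen hO, by simp only [preimage_iInter, hOV]⟩

/-- If a separable metrizable space has a countable cover by closed subspaces each of
which is a λ-set, then the space itself is a λ-set. -/
theorem lambda_of_countable_closed_cover (X : Type*) [TopologicalSpace X]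
    [SeparableSpace X] [MetrizableSpace X]
    (C : Set (Set X)) (hC : C.Countable) (hcl : ∀ c ∈ C, IsClosed c)
    (hlam : ∀ c ∈ C, IsLambdaSpace ↥c) (hcov : ⋃₀ C = univ) :
    IsLambdaSpace X := by
  refine ⟨?_, inferInstance, inferInstance, fun A hA => ?_⟩
  · let := metrizableSpaceMetric X
    have := UniformSpace.secondCountable_of_separable X
    rcases C.eq_empty_or_nonempty with rfl | hne
    · have hX : IsEmpty X := univ_eq_empty_iff.1 (by simpa using hcov.symm)
      exact ⟨{s | IsClopen s}, isTopologicalBasis_of_isOpen_of_nhds (fun s hs => hs.isOpen)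
        fun x => isEmptyElim x, fun s hs => hs⟩
    · obtain ⟨c, rfl⟩ := hC.exists_eq_range hne
      exact zeroDimensional_of_closed_cover (fun n => hcl _ ⟨n, rfl⟩)
        (fun n => (hlam _ ⟨n, rfl⟩).1) hcov
  · have hG : ∀ c ∈ C, ∃ G : Set X, IsGδ G ∧ ((↑) ⁻¹' G : Set c) = (↑) ⁻¹' A := fun c hc =>
      ((hlam c hc).2.2.2 _ (hA.preimage Subtype.val_injective)).exists_preimage_subtype_val_eq
    choose! G hG hGA using hG
    have hmem : ∀ c ∈ C, ∀ x ∈ c, x ∈ G c ↔ x ∈ A := fun c hc x hx =>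
      Set.ext_iff.1 (hGA c hc) ⟨x, hx⟩
    have hAeq : A = ⋂ c ∈ C, G c ∪ cᶜ := by
      ext x
      simp only [mem_iInter, mem_union, mem_compl_iff]
      constructor
      · intro hx c hc
        by_cases hxc : x ∈ c
        · exact Or.inl ((hmem c hc x hxc).2 hx)
        · exact Or.inr hxc
      · intro h
        obtain ⟨c, hc, hxc⟩ := mem_sUnion.1 (hcov.symm ▸ mem_univ x)
        exact (hmem c hc x hxc).1 ((h c hc).resolve_right fun h' => h' hxc)
    rw [hAeq]
    exact .biInter hC fun c hc => (hG c hc).union (hcl c hc).isOpen_compl.isGδ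
end

section
/- If X is a separable metrizable space that is countable dense homogeneous and meager in itself, then every countable subset of X is a relative G_δ-set in X. -/
open Set TopologicalSpace

/-- A space is countable dense homogeneous (CDH) if for any two countable dense subsets
`D`, `E` there is a homeomorphism of the space mapping `D` onto `E`. -/
def IsCDH (X : Type*) [TopologicalSpace X] : Prop :=
  ∀ D E : Set X, D.Countable → Dense D → E.Countable → Dense E →
    ∃ f : X ≃ₜ X, f '' D = E

theorem exists_seq_isOpen_dense_iInter_eq_empty {X : Type*} [TopologicalSpace X]
    (h : IsMeagre (univ : Set X)) :
    ∃ G : ℕ → Set X, (∀ n, IsOpen (G n)) ∧ (∀ n, Dense (G n)) ∧ ⋂ n, G n = ∅ := by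
  rw [IsMeagre, compl_univ, mem_residual_iff] at h
  obtain ⟨S, ho, hd, hc, hS⟩ := h
  obtain ⟨G, hG⟩ := (hc.insert univ).exists_eq_range (insert_nonempty _ _)
  have hmem : ∀ n, G n ∈ insert univ S := fun n => hG ▸ mem_range_self n
  refine ⟨G, fun n => ?_, fun n => ?_, ?_⟩
  · rcases hmem n with h | h
    · exact h ▸ isOpen_univ
    · exact ho _ h
  · rcases hmem n with h | h
    · exact h ▸ dense_univ
    · exact hd _ h
  · rwa [← sInter_range, ← hG, sInter_insert, univ_inter, ← subset_empty_iff]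

theorem dense_biInter_le_of_isOpen {X : Type*} [TopologicalSpace X] {G : ℕ → Set X}
    (ho : ∀ n, IsOpen (G n)) (hd : ∀ n, Dense (G n)) (n : ℕ) : Dense (⋂ k ≤ n, G k) := by
  induction n with
  | zero => simpa using hd 0
  | succ n ih =>
    rw [biInter_le_succ]
    exact ih.inter_of_isOpen_right (hd _) (ho _)

/-- A second countable `T₁` space which is meager in itself has a countable dense
`Gδ` subset. -/
theorem exists_countable_dense_isGδ_of_isMeagre_univ {X : Type*} [TopologicalSpace X]
    [SecondCountableTopology X] [T1Space X] (h : IsMeagre (univ : Set X)) :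
    ∃ D : Set X, D.Countable ∧ Dense D ∧ IsGδ D := by
  obtain ⟨G, ho, hd, hG⟩ := exists_seq_isOpen_dense_iInter_eq_empty h
  have hbasis := isBasis_countableBasis X
  have : Countable (countableBasis X) := (countable_countableBasis X).to_subtype
  obtain ⟨e, he⟩ := exists_injective_nat (countableBasis X)
  have hex : ∀ u : countableBasis X, ∃ x, x ∈ (u : Set X) ∩ ⋂ k ≤ e u, G k := fun u =>
    (dense_biInter_le_of_isOpen ho hd (e u)).inter_open_nonempty _ (hbasis.isOpen u.2)
      (nonempty_of_mem_countableBasis u.2)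
  choose d hdu hdG using hex
  refine ⟨range d, countable_range d, ?_, ?_⟩
  · exact hbasis.dense_iff.2 fun o hob _ => ⟨d ⟨o, hob⟩, hdu ⟨o, hob⟩, mem_range_self _⟩
  · have hfin : ∀ n, (range d \ G n).Finite := fun n => by
      refine (((finite_lt_nat n).preimage he.injOn).image d).subset ?_
      rintro _ ⟨⟨u, rfl⟩, hu⟩
      refine ⟨u, ?_, rfl⟩
      by_contra hlt
      exact hu (mem_iInter₂.1 (hdG u) n (not_lt.1 hlt))
    have heq : range d = ⋂ n, (G n ∪ range d \ G n) := by
      simp_rw [union_sdiff_self, ← iInter_union, hG, empty_union]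
    rw [heq]
    exact .iInter fun n => (ho n).isGδ.union (hfin n).isGδ

/-- A separable metrizable CDH space which is meager in itself has all countable
subsets relative Gδ. -/
theorem countable_isGδ_of_CDH_meager (X : Type*) [TopologicalSpace X]
    [SeparableSpace X] [MetrizableSpace X]
    (hcdh : IsCDH X) (hmeager : IsMeagre (univ : Set X)) :
    ∀ A : Set X, A.Countable → IsGδ A := by
  intro A hA
  have : SecondCountableTopology X := by
    let _ := metrizableSpaceMetric X
    exact UniformSpace.secondCountable_of_separable X
  obtain ⟨D, hDc, hDd, hDG⟩ := exists_countable_dense_isGδ_of_isMeagre_univ hmeager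
  obtain ⟨f, hf⟩ := hcdh (A ∪ D) D (hA.union hDc) (hDd.mono subset_union_right) hDc hDd
  have hAD : IsGδ (A ∪ D) := by
    rw [← f.injective.preimage_image (A ∪ D), hf]
    exact hDG.preimage f.continuous
  have hEq : A = (A ∪ D) ∩ (D \ A)ᶜ := by
    ext x
    simp only [mem_inter_iff, mem_union, mem_compl_iff, mem_sdiff]
    tauto
  rw [hEq]
  exact hAD.inter (hDc.mono sdiff_subset).isGδ_compl
end

section
/- If X ⊆ 2^ω is a λ'-set, then its tail-equivalence saturation X* = {y ∈ 2^ω : ∃ x ∈ X, y ∼ x} is a λ'-set. -/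
open Set

/-- The Cantor space `2^ω`. -/
abbrev Cantor : Type := ℕ → Bool

/-- `X ⊆ 2^ω` is a λ'-set if every countable `Y ⊆ 2^ω` is a relative Gδ-set in `X ∪ Y`. -/
def IsLambdaPrimeSet (X : Set Cantor) : Prop :=
  ∀ Y : Set Cantor, Y.Countable → ∃ G : Set Cantor, IsGδ G ∧ Y = G ∩ (X ∪ Y)

/-- Tail equivalence on the Cantor space. -/
def TailEquiv (x y : Cantor) : Prop :=
  ∃ m n : ℕ, ∀ k : ℕ, x (m + k) = y (n + k)

/-- The saturation of a set under tail equivalence. -/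
def saturation (X : Set Cantor) : Set Cantor :=
  {y | ∃ x ∈ X, TailEquiv y x}

/-- `X` is a λ'-set as soon as every countable set lies in a Gδ set meeting `X` in a countable set. -/
theorem IsLambdaPrimeSet.of_countable_inter {X : Set Cantor}
    (h : ∀ Y : Set Cantor, Y.Countable → ∃ G : Set Cantor, IsGδ G ∧ Y ⊆ G ∧ (G ∩ X).Countable) :
    IsLambdaPrimeSet X := by
  intro Y hY
  obtain ⟨G, hG, hYG, hC⟩ := h Y hY
  refine ⟨G ∩ ((G ∩ X) \ Y)ᶜ, hG.inter (hC.mono sdiff_subset).isGδ_compl, ?_⟩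
  ext y
  have := @hYG y
  simp only [mem_inter_iff, mem_compl_iff, mem_sdiff, mem_union]
  tauto

/-- A countable union of preimages of a λ'-set under continuous maps with countable fibers
is a λ'-set. -/
theorem IsLambdaPrimeSet.iUnion_preimage {ι : Type*} [Countable ι] {X : Set Cantor}
    (hX : IsLambdaPrimeSet X) {f : ι → Cantor → Cantor} (hf : ∀ i, Continuous (f i))
    (hfib : ∀ i z, (f i ⁻¹' {z}).Countable) : IsLambdaPrimeSet (⋃ i, f i ⁻¹' X) := by
  refine .of_countable_inter fun Y hY => ?_
  choose G hG hYG using fun i => hX (f i '' Y) (hY.image _)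
  refine ⟨⋂ i, f i ⁻¹' G i, .iInter fun i => .preimage (hf i) (hG i), ?_, ?_⟩
  · refine subset_iInter fun i y hy => ?_
    have : f i y ∈ G i ∩ (X ∪ f i '' Y) := hYG i ▸ mem_image_of_mem _ hy
    exact this.1
  · refine (countable_iUnion fun i => (hY.image (f i)).biUnion fun z _ => hfib i z).mono ?_
    rintro y ⟨hyG, hyX⟩
    obtain ⟨i, hi⟩ := mem_iUnion.1 hyX
    have hy : f i y ∈ f i '' Y := by
      rw [hYG i]
      exact ⟨mem_iInter.1 hyG i, .inl hi⟩
    exact mem_iUnion.2 ⟨i, mem_biUnion hy rfl⟩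

/-- Replace the first `m` entries of a sequence by the finite word `s`. -/
def replacePrefix (s : List Bool) (m : ℕ) (y : Cantor) : Cantor :=
  fun k => if k < s.length then s.getD k false else y (m + (k - s.length))

theorem continuous_replacePrefix (s : List Bool) (m : ℕ) : Continuous (replacePrefix s m) := by
  refine continuous_pi fun k => ?_
  unfold replacePrefix
  split_ifs <;> fun_prop

theorem finite_replacePrefix_fiber (s : List Bool) (m : ℕ) (z : Cantor) :
    (replacePrefix s m ⁻¹' {z}).Finite := by
  refine Finite.of_finite_image (f := fun (y : Cantor) (i : Fin m) => y i) (toFinite _) ?_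
  intro y hy y' hy' h
  funext k
  by_cases hk : k < m
  · exact congrFun h ⟨k, hk⟩
  · have := congrFun (hy.trans hy'.symm) (s.length + (k - m))
    simpa [replacePrefix, Nat.add_sub_cancel' (not_lt.1 hk)] using this

theorem saturation_eq_iUnion_preimage (X : Set Cantor) :
    saturation X = ⋃ p : List Bool × ℕ, replacePrefix p.1 p.2 ⁻¹' X := by
  ext y
  simp only [saturation, TailEquiv, mem_ofPred_eq, mem_iUnion, mem_preimage, Prod.exists]
  constructor
  · rintro ⟨x, hx, m, n, h⟩
    refine ⟨List.ofFn fun i : Fin n => x i, m, ?_⟩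
    convert hx using 1
    funext k
    by_cases hk : k < n
    · simp [replacePrefix, hk]
    · simp [replacePrefix, hk, h, Nat.add_sub_cancel' (not_lt.1 hk)]
  · rintro ⟨s, m, h⟩
    exact ⟨_, h, m, s.length, fun k => by simp [replacePrefix]⟩

/-- If `X` is a λ'-set then its tail-equivalence saturation is a λ'-set. -/
theorem saturation_lambdaPrime (X : Set Cantor) (hX : IsLambdaPrimeSet X) :
    IsLambdaPrimeSet (saturation X) := by
  rw [saturation_eq_iUnion_preimage]
  exact hX.iUnion_preimage (fun p => continuous_replacePrefix p.1 p.2)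
    fun p z => (finite_replacePrefix_fiber p.1 p.2 z).countable
end

section
/- Let X ⊆ 2^ω be an uncountable saturated λ-set. Then X is relatively CDH in 2^ω: for every pair D₀, D₁ of countable dense subsets of X there is a homeomorphism h : 2^ω → 2^ω such that h[D₀] = D₁ and h[X] = X. -/
open Set

/-- `X ⊆ 2^ω` is a λ-set if every countable subset of `X` is a relative Gδ-set in `X`. -/
def IsLambdaSet (X : Set Cantor) : Prop :=
  ∀ A : Set Cantor, A ⊆ X → A.Countable → ∃ G : Set Cantor, IsGδ G ∧ A = G ∩ X

/-- A set is saturated if it equals its tail-equivalence saturation. -/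
def Saturated (X : Set Cantor) : Prop := X = saturation X

open Topology Filter

lemma TailEquiv.refl (x : Cantor) : TailEquiv x x := ⟨0, 0, fun _ => rfl⟩

lemma TailEquiv.symm {x y : Cantor} (h : TailEquiv x y) : TailEquiv y x := by
  obtain ⟨m, n, h⟩ := h
  exact ⟨n, m, fun k => (h k).symm⟩

lemma TailEquiv.trans {x y z : Cantor} (hxy : TailEquiv x y) (hyz : TailEquiv y z) :
    TailEquiv x z := by
  obtain ⟨m, n, h⟩ := hxy
  obtain ⟨p, q, h'⟩ := hyz
  refine ⟨m + p, q + n, fun k => ?_⟩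
  have h₁ := h (p + k)
  have h₂ := h' (n + k)
  rw [show m + p + k = m + (p + k) by ring, h₁, show n + (p + k) = p + (n + k) by ring, h₂,
    show q + n + k = q + (n + k) by ring]

lemma countable_tailClass (x : Cantor) : {y | TailEquiv y x}.Countable := by
  have : {y | TailEquiv y x} = ⋃ m : ℕ, ⋃ n : ℕ, {y | ∀ k, y (m + k) = x (n + k)} := by
    ext y
    simp [TailEquiv]
  rw [this]
  refine countable_iUnion fun m => countable_iUnion fun n => ?_
  refine Set.MapsTo.countable_of_injOn (t := (univ : Set (Fin m → Bool)))
    (f := fun y i => y i) (fun _ _ => mem_univ _) ?_ (to_countable _)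
  intro y hy z hz hyz
  funext k
  rcases lt_or_ge k m with hk | hk
  · exact congrFun hyz ⟨k, hk⟩
  · obtain ⟨j, rfl⟩ := Nat.exists_eq_add_of_le hk
    rw [hy j, hz j]

lemma countable_saturation {S : Set Cantor} (hS : S.Countable) : (saturation S).Countable := by
  have : saturation S = ⋃ x ∈ S, {y | TailEquiv y x} := by
    ext y
    simp [saturation]
  rw [this]
  exact hS.biUnion fun x _ => countable_tailClass x

lemma subset_saturation (S : Set Cantor) : S ⊆ saturation S :=
  fun x hx => ⟨x, hx, .refl x⟩

lemma mem_saturation_of_tailEquiv {S : Set Cantor} {x y : Cantor} (hx : x ∈ saturation S)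
    (h : TailEquiv y x) : y ∈ saturation S := by
  obtain ⟨z, hz, hxz⟩ := hx
  exact ⟨z, hz, h.trans hxz⟩

lemma cylinder_mem_nhds (x : Cantor) (n : ℕ) : {y : Cantor | ∀ i < n, y i = x i} ∈ 𝓝 x := by
  have : {y : Cantor | ∀ i < n, y i = x i} = PiNat.cylinder x n := by
    ext y
    simp [PiNat.mem_cylinder_iff]
  rw [this]
  exact (PiNat.isOpen_cylinder _ x n).mem_nhds (PiNat.self_mem_cylinder x n)

lemma exists_cylinder_subset {x : Cantor} {U : Set Cantor} (hU : U ∈ 𝓝 x) :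
    ∃ n, ∀ y : Cantor, (∀ i < n, y i = x i) → y ∈ U := by
  obtain ⟨V, ⟨z, n, rfl⟩, hxV, hVU⟩ :=
    (PiNat.isTopologicalBasis_cylinders (fun _ : ℕ => Bool)).mem_nhds_iff.1 hU
  refine ⟨n, fun y hy => hVU ?_⟩
  rw [PiNat.mem_cylinder_iff] at hxV ⊢
  exact fun i hi => (hy i hi).trans (hxV i hi)

lemma dense_tailClass (x : Cantor) : Dense {y | TailEquiv y x} := by
  intro y
  rw [mem_closure_iff_nhds]
  intro U hU
  obtain ⟨n, hn⟩ := exists_cylinder_subset hU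
  refine ⟨fun k => if k < n then y k else x k, hn _ fun i hi => by simp [hi], n, n, fun k => ?_⟩
  simp

lemma Saturated.mem_of_tailEquiv {X : Set Cantor} (hX : Saturated X) {x y : Cantor} (hx : x ∈ X)
    (h : TailEquiv y x) : y ∈ X := by
  rw [hX]
  exact ⟨x, hx, h⟩

lemma Saturated.dense {X : Set Cantor} (hX : Saturated X) (hne : X.Nonempty) : Dense X := by
  obtain ⟨x, hx⟩ := hne
  exact (dense_tailClass x).mono fun _ hy => hX.mem_of_tailEquiv hx hy

open Classical in
/-- The map sending `d` to `d'` which, on any other point `x`, acts by replacing the initial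
segment on which `x` follows `d` (and the first differing bit) by the one following `d'`. -/
noncomputable def branchMap (d d' x : Cantor) : Cantor :=
  fun k => if ∀ i < k, x i = d i then xor (x k) (xor (d k) (d' k)) else x k

lemma branchMap_agree_iff (d d' x : Cantor) (k : ℕ) :
    (∀ i < k, branchMap d d' x i = d' i) ↔ ∀ i < k, x i = d i := by
  induction k with
  | zero => simp
  | succ k ih =>
    rw [Nat.forall_lt_succ_right, Nat.forall_lt_succ_right, ih]
    refine and_congr_right fun h => ?_
    rw [branchMap, if_pos h]
    cases x k <;> cases d k <;> cases d' k <;> simp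

lemma branchMap_branchMap (d d' x : Cantor) : branchMap d' d (branchMap d d' x) = x := by
  funext k
  rw [branchMap]
  simp only [branchMap_agree_iff]
  split_ifs with h
  · rw [branchMap, if_pos h]
    cases x k <;> cases d k <;> cases d' k <;> rfl
  · rw [branchMap, if_neg h]

lemma continuous_branchMap (d d' : Cantor) : Continuous (branchMap d d') := by
  refine continuous_pi fun k => IsLocallyConstant.continuous ?_
  rw [IsLocallyConstant.iff_eventually_eq]
  intro x
  filter_upwards [cylinder_mem_nhds x (k + 1)] with y hy
  have hk : y k = x k := hy k k.lt_succ_self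
  have : (∀ i < k, y i = d i) ↔ ∀ i < k, x i = d i :=
    forall₂_congr fun i hi => by rw [hy i (hi.trans k.lt_succ_self)]
  simp only [branchMap, this, hk]

/-- `branchMap` as a homeomorphism. -/
noncomputable def branchHomeo (d d' : Cantor) : Cantor ≃ₜ Cantor where
  toFun := branchMap d d'
  invFun := branchMap d' d
  left_inv := branchMap_branchMap d d'
  right_inv := branchMap_branchMap d' d
  continuous_toFun := continuous_branchMap d d'
  continuous_invFun := continuous_branchMap d' d

lemma branchMap_self (d d' : Cantor) : branchMap d d' d = d' := by
  funext k
  simp [branchMap]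

lemma tailEquiv_branchMap {d x : Cantor} (d' : Cantor) (h : x ≠ d) :
    TailEquiv (branchMap d d' x) x := by
  obtain ⟨n, hn⟩ := Function.ne_iff.1 h
  refine ⟨n + 1, n + 1, fun k => ?_⟩
  rw [branchMap, if_neg]
  exact fun hk => hn (hk n (by omega))

lemma branchMap_apply_of_lt {d d' : Cantor} {k : ℕ} (hd : ∀ i < k, d' i = d i) (x : Cantor)
    {i : ℕ} (hi : i < k) : branchMap d d' x i = x i := by
  simp [branchMap, hd i hi]

lemma branchMap_of_not_agree {d d' x : Cantor} {k : ℕ} (hd : ∀ i < k, d' i = d i)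
    (hx : ¬ ∀ i < k, x i = d i) : branchMap d d' x = x := by
  funext j
  rcases lt_or_ge j k with hj | hj
  · exact branchMap_apply_of_lt hd x hj
  · rw [branchMap, if_neg]
    exact fun h => hx fun i hi => h i (hi.trans_le hj)

/-- `h` carries the finite set `A ⊆ D` into `D`, matching membership in `D₀` with membership in
`D₁`, and preserves tail classes off `A`. -/
structure IsPartialMatching (D D₀ D₁ : Set Cantor) (h : Cantor ≃ₜ Cantor) (A : Set Cantor) :
    Prop where
  finite : A.Finite
  subset : A ⊆ D
  map_mem : ∀ a ∈ A, h a ∈ D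
  mem_iff : ∀ a ∈ A, a ∈ D₀ ↔ h a ∈ D₁
  tailEquiv : ∀ x ∉ A, TailEquiv (h x) x

lemma IsPartialMatching.symm {D D₀ D₁ A : Set Cantor} {h : Cantor ≃ₜ Cantor}
    (H : IsPartialMatching D D₀ D₁ h A) : IsPartialMatching D D₁ D₀ h.symm (h '' A) where
  finite := H.finite.image h
  subset := by
    rintro _ ⟨a, ha, rfl⟩
    exact H.map_mem a ha
  map_mem := by
    rintro _ ⟨a, ha, rfl⟩
    simpa using H.subset ha
  mem_iff := by
    rintro _ ⟨a, ha, rfl⟩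
    simpa using (H.mem_iff a ha).symm
  tailEquiv y hy := by
    have := H.tailEquiv (h.symm y) fun hA => hy ⟨_, hA, by simp⟩
    simpa using this.symm

/-- `(h', A')` extends `(h, A)`: on `A` and outside `O` nothing changes, in either direction, and
the first `N` coordinates do not change anywhere. -/
structure IsExtension (O : Set Cantor) (N : ℕ) (h : Cantor ≃ₜ Cantor) (A : Set Cantor)
    (h' : Cantor ≃ₜ Cantor) (A' : Set Cantor) : Prop where
  subset : A ⊆ A'
  eq_of_mem : ∀ x ∈ A, h' x = h x
  eq_of_notMem : ∀ x ∉ O, h' x = h x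
  symm_eq_of_notMem : ∀ y ∉ O, h'.symm y = h.symm y
  agree : ∀ x, ∀ i < N, h' x i = h x i
  symm_agree : ∀ y, ∀ i < N, h'.symm y i = h.symm y i

lemma IsExtension.refl (O : Set Cantor) (N : ℕ) (h : Cantor ≃ₜ Cantor) (A : Set Cantor) :
    IsExtension O N h A h A :=
  ⟨Subset.rfl, fun _ _ => rfl, fun _ _ => rfl, fun _ _ => rfl, fun _ _ _ => rfl, fun _ _ _ => rfl⟩

lemma IsExtension.trans {O O' : Set Cantor} {N N' : ℕ} {h h' h'' : Cantor ≃ₜ Cantor}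
    {A A' A'' : Set Cantor} (H : IsExtension O N h A h' A') (H' : IsExtension O' N' h' A' h'' A'')
    (hO : O' ⊆ O) (hN : N ≤ N') : IsExtension O N h A h'' A'' where
  subset := H.subset.trans H'.subset
  eq_of_mem x hx := (H'.eq_of_mem x (H.subset hx)).trans (H.eq_of_mem x hx)
  eq_of_notMem x hx := (H'.eq_of_notMem x fun h => hx (hO h)).trans (H.eq_of_notMem x hx)
  symm_eq_of_notMem x hx :=
    (H'.symm_eq_of_notMem x fun h => hx (hO h)).trans (H.symm_eq_of_notMem x hx)
  agree x i hi := (H'.agree x i (hi.trans_le hN)).trans (H.agree x i hi)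
  symm_agree x i hi := (H'.symm_agree x i (hi.trans_le hN)).trans (H.symm_agree x i hi)

lemma IsExtension.symm {O : Set Cantor} {N : ℕ} {h h' : Cantor ≃ₜ Cantor} {A A' : Set Cantor}
    (H : IsExtension O N h A h' A') : IsExtension O N h.symm (h '' A) h'.symm (h' '' A') where
  subset := by
    rintro _ ⟨a, ha, rfl⟩
    exact ⟨a, H.subset ha, H.eq_of_mem a ha⟩
  eq_of_mem := by
    rintro _ ⟨a, ha, rfl⟩
    rw [← H.eq_of_mem a ha, h'.symm_apply_apply, H.eq_of_mem a ha, h.symm_apply_apply]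
  eq_of_notMem := H.symm_eq_of_notMem
  symm_eq_of_notMem := H.eq_of_notMem
  agree := H.symm_agree
  symm_agree := H.agree

lemma IsPartialMatching.exists_extension {D D₀ D₁ A : Set Cantor} {h : Cantor ≃ₜ Cantor}
    (H : IsPartialMatching D D₀ D₁ h A)
    (hD : ∀ x ∈ D, ∀ y, TailEquiv y x → y ∈ D) (hD₁ : D₁ ⊆ D)
    (hd₁ : Dense D₁) (hd₁' : Dense (D \ D₁))
    {O : Set Cantor} (hO : IsOpen O) (hDO : D ⊆ O) (N : ℕ) {d : Cantor} (hd : d ∈ D) :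
    ∃ h' A', IsPartialMatching D D₀ D₁ h' A' ∧ IsExtension O N h A h' A' ∧ d ∈ A' := by
  by_cases hdA : d ∈ A
  · exact ⟨h, A, H, .refl .., hdA⟩
  have hhd : h d ∈ D := hD d hd _ (H.tailEquiv d hdA)
  obtain ⟨k, hk⟩ := exists_cylinder_subset (x := d)
    (U := (((O ∩ h ⁻¹' O) ∩ Aᶜ) ∩ h ⁻¹' {y | ∀ i < N, y i = h d i}) ∩ {y | ∀ i < N, y i = d i}) <|
    inter_mem (inter_mem (inter_mem (inter_mem (hO.mem_nhds (hDO hd))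
      ((hO.preimage h.continuous).mem_nhds (hDO hhd))) (H.finite.isClosed.isOpen_compl.mem_nhds hdA))
      (h.continuous.continuousAt.preimage_mem_nhds (cylinder_mem_nhds _ N)))
      (cylinder_mem_nhds d N)
  obtain ⟨d', hd'U, hd'D, hd'⟩ : ∃ d', (∀ i < k, d' i = d i) ∧ h d' ∈ D ∧
      (d ∈ D₀ ↔ h d' ∈ D₁) := by
    have key : ∀ S : Set Cantor, Dense S → ∃ d', (∀ i < k, d' i = d i) ∧ h d' ∈ S := by
      intro S hS
      have hmem : h.symm ⁻¹' {y | ∀ i < k, y i = d i} ∈ 𝓝 (h d) :=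
        h.symm.continuous.continuousAt.preimage_mem_nhds
          (by simpa using cylinder_mem_nhds d k)
      obtain ⟨e, he, heS⟩ := mem_closure_iff_nhds.1 (hS (h d)) _ hmem
      exact ⟨h.symm e, he, by simpa using heS⟩
    by_cases hdD₀ : d ∈ D₀
    · obtain ⟨d', h₁, h₂⟩ := key _ hd₁
      exact ⟨d', h₁, hD₁ h₂, by simp [hdD₀, h₂]⟩
    · obtain ⟨d', h₁, h₂⟩ := key _ hd₁'
      exact ⟨d', h₁, h₂.1, by simp [hdD₀, h₂.2]⟩
  have hd'U' : ∀ i < k, d i = d' i := fun i hi => (hd'U i hi).symm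
  have hfix : ∀ x, (¬ ∀ i < k, x i = d i) → branchMap d d' x = x := fun x hx =>
    branchMap_of_not_agree hd'U hx
  have hfix' : ∀ x, (¬ ∀ i < k, x i = d i) → branchMap d' d x = x := fun x hx =>
    branchMap_of_not_agree hd'U' fun hx' => hx fun i hi => (hx' i hi).trans (hd'U i hi)
  have hagree : ∀ x, (∀ i < k, x i = d i) → ∀ i < k, branchMap d d' x i = d i :=
    fun x hx i hi => (branchMap_apply_of_lt hd'U x hi).trans (hx i hi)
  have hN : ∀ i < N, i < k := by
    intro i hi
    by_contra hik
    have := (hk (fun j => if j < k then d j else !(d j)) fun j hj => by simp [hj]).2 i hi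
    simp [hik] at this
  have hA : ∀ a ∈ A, branchMap d d' a = a := fun a ha => hfix a fun h => (hk a h).1.1.2 ha
  refine ⟨(branchHomeo d d').trans h, insert d A, ⟨H.finite.insert d, ?_, ?_, ?_, ?_⟩,
    ⟨subset_insert _ _, ?_, ?_, ?_, ?_, ?_⟩, mem_insert _ _⟩
  · exact insert_subset hd H.subset
  · rintro a (rfl | ha)
    · change h (branchMap a d' a) ∈ D
      rwa [branchMap_self]
    · change h (branchMap d d' a) ∈ D
      rw [hA a ha]
      exact H.map_mem a ha
  · rintro a (rfl | ha)
    · change a ∈ D₀ ↔ h (branchMap a d' a) ∈ D₁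
      rwa [branchMap_self]
    · change a ∈ D₀ ↔ h (branchMap d d' a) ∈ D₁
      rw [hA a ha]
      exact H.mem_iff a ha
  · intro x hx
    rw [mem_insert_iff, not_or] at hx
    refine (H.tailEquiv (branchMap d d' x) fun hxA => ?_).trans (tailEquiv_branchMap d' hx.1)
    by_cases hxU : ∀ i < k, x i = d i
    · exact (hk _ (hagree x hxU)).1.1.2 hxA
    · rw [hfix x hxU] at hxA
      exact hx.2 hxA
  · exact fun x hx => congrArg h (hA x hx)
  · exact fun x hx => congrArg h (hfix x fun hU => hx (hk x hU).1.1.1.1)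
  · intro y hy
    refine hfix' (h.symm y) fun hU => hy ?_
    simpa using (hk _ hU).1.1.1.2
  · intro x i hi
    change h (branchMap d d' x) i = h x i
    by_cases hxU : ∀ i < k, x i = d i
    · rw [(hk _ (hagree x hxU)).1.2 i hi, (hk x hxU).1.2 i hi]
    · rw [hfix x hxU]
  · exact fun y i hi => branchMap_apply_of_lt hd'U' _ (hN i hi)

/-- The coordinatewise limit of a sequence of maps whose first `n` coordinates are settled
from stage `n` on. -/
def stableLimit (f : ℕ → Cantor → Cantor) (x : Cantor) : Cantor := fun k => f (k + 1) x k

section stableLimit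

variable {f g : ℕ → Cantor → Cantor}

lemma stableLimit_apply (hf : ∀ n x, ∀ i < n, f (n + 1) x i = f n x i) {n i : ℕ} (hi : i < n)
    (x : Cantor) : stableLimit f x i = f n x i := by
  induction n, hi using Nat.le_induction with
  | base => rfl
  | succ n hn ih => rw [ih, hf n x i hn]

lemma stableLimit_eq {x y : Cantor} {n : ℕ} (hx : ∀ m ≥ n, f m x = y)
    (hf : ∀ n x, ∀ i < n, f (n + 1) x i = f n x i) : stableLimit f x = y := by
  funext k
  rw [stableLimit_apply hf (lt_of_lt_of_le k.lt_succ_self (le_max_left (k + 1) n)),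
    hx _ (le_max_right _ _)]

lemma continuous_stableLimit (hc : ∀ n, Continuous (f n)) : Continuous (stableLimit f) :=
  continuous_pi fun k => (continuous_apply k).comp (hc (k + 1))

lemma stableLimit_leftInverse (hf : ∀ n x, ∀ i < n, f (n + 1) x i = f n x i)
    (hg : ∀ n x, ∀ i < n, g (n + 1) x i = g n x i) (hc : ∀ n, Continuous (f n))
    (hfg : ∀ n x, f n (g n x) = x) (x : Cantor) :
    stableLimit f (stableLimit g x) = x := by
  have h₁ : Tendsto (fun n => g n x) atTop (𝓝 (stableLimit g x)) := by
    rw [tendsto_pi_nhds]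
    intro i
    refine tendsto_const_nhds.congr' ?_
    filter_upwards [eventually_gt_atTop i] with n hn using stableLimit_apply hg hn x
  have h₂ : Tendsto (fun n => stableLimit f (g n x)) atTop (𝓝 x) := by
    rw [tendsto_pi_nhds]
    intro i
    refine tendsto_const_nhds.congr' ?_
    filter_upwards [eventually_gt_atTop i] with n hn
    rw [stableLimit_apply hf hn, hfg]
  exact tendsto_nhds_unique (((continuous_stableLimit hc).tendsto _).comp h₁) h₂

end stableLimit

lemma exists_homeomorph_of_matching {D D₀ D₁ : Set Cantor} (hDc : D.Countable) (hne : D.Nonempty)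
    (hD : ∀ x ∈ D, ∀ y, TailEquiv y x → y ∈ D) (hD₀ : D₀ ⊆ D) (hD₁ : D₁ ⊆ D)
    (hd₀ : Dense D₀) (hd₀' : Dense (D \ D₀)) (hd₁ : Dense D₁) (hd₁' : Dense (D \ D₁))
    {O : ℕ → Set Cantor} (hO : ∀ n, IsOpen (O n)) (hanti : Antitone O) (hDO : ∀ n, D ⊆ O n) :
    ∃ h : Cantor ≃ₜ Cantor,
      (∀ x ∈ D, h x ∈ D) ∧ (∀ y ∈ D, h.symm y ∈ D) ∧ (∀ x ∈ D, x ∈ D₀ ↔ h x ∈ D₁) ∧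
      (∀ n, ∀ x ∉ O n, TailEquiv (h x) x) ∧ ∀ n, ∀ y ∉ O n, TailEquiv (h.symm y) y := by
  obtain ⟨e, he⟩ := hDc.exists_eq_range hne
  have heD : ∀ n, e n ∈ D := fun n => he ▸ mem_range_self n
  have step : ∀ (n : ℕ) (p : {p : (Cantor ≃ₜ Cantor) × Set Cantor //
      IsPartialMatching D D₀ D₁ p.1 p.2}), ∃ q : {p : (Cantor ≃ₜ Cantor) × Set Cantor //
      IsPartialMatching D D₀ D₁ p.1 p.2},
      IsExtension (O n) n p.1.1 p.1.2 q.1.1 q.1.2 ∧ e n ∈ q.1.2 ∧ e n ∈ q.1.1 '' q.1.2 := by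
    rintro n ⟨⟨h, A⟩, H⟩
    obtain ⟨h', A', H', hE, hmem⟩ :=
      H.exists_extension hD hD₁ hd₁ hd₁' (hO n) (hDO n) n (heD n)
    obtain ⟨k, B, H'', hE', hmem'⟩ :=
      H'.symm.exists_extension hD hD₀ hd₀ hd₀' (hO n) (hDO n) n (heD n)
    have hE'' := hE'.symm
    have himg : h'.symm '' (h' '' A') = A' := by simp [image_image]
    have himg' : k.symm '' (k '' B) = B := by simp [image_image]
    rw [himg] at hE''
    refine ⟨⟨(k.symm, k '' B), H''.symm⟩, hE.trans hE'' Subset.rfl le_rfl, hE''.subset hmem, ?_⟩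
    simpa only [himg'] using hmem'
  choose next hnext using step
  have H₀ : IsPartialMatching D D₀ D₁ (Homeomorph.refl Cantor) ∅ :=
    ⟨finite_empty, empty_subset _, by simp, by simp, fun x _ => .refl x⟩
  let s : ℕ → {p : (Cantor ≃ₜ Cantor) × Set Cantor // IsPartialMatching D D₀ D₁ p.1 p.2} :=
    fun n => Nat.rec ⟨(Homeomorph.refl Cantor, ∅), H₀⟩ (fun n p => next n p) n
  have hs : ∀ n, IsExtension (O n) n (s n).1.1 (s n).1.2 (s (n + 1)).1.1 (s (n + 1)).1.2 ∧
      e n ∈ (s (n + 1)).1.2 ∧ e n ∈ (s (n + 1)).1.1 '' (s (n + 1)).1.2 := fun n => hnext n (s n)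
  have hle : ∀ n m, n ≤ m → IsExtension (O n) n (s n).1.1 (s n).1.2 (s m).1.1 (s m).1.2 := by
    intro n m hnm
    induction m, hnm using Nat.le_induction with
    | base => exact .refl ..
    | succ m hm ih => exact ih.trans (hs m).1 (hanti hm) hm
  have hf : ∀ n x, ∀ i < n, (s (n + 1)).1.1 x i = (s n).1.1 x i := fun n => (hs n).1.agree
  have hg : ∀ n x, ∀ i < n, (s (n + 1)).1.1.symm x i = (s n).1.1.symm x i :=
    fun n => (hs n).1.symm_agree
  let h : Cantor ≃ₜ Cantor :=
    { toFun := stableLimit fun n => (s n).1.1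
      invFun := stableLimit fun n => (s n).1.1.symm
      left_inv := stableLimit_leftInverse hg hf (fun n => (s n).1.1.symm.continuous)
        fun n => (s n).1.1.symm_apply_apply
      right_inv := stableLimit_leftInverse hf hg (fun n => (s n).1.1.continuous)
        fun n => (s n).1.1.apply_symm_apply
      continuous_toFun := continuous_stableLimit fun n => (s n).1.1.continuous
      continuous_invFun := continuous_stableLimit fun n => (s n).1.1.symm.continuous }
  have hA : ∀ n, ∀ a ∈ (s n).1.2, h a = (s n).1.1 a := fun n a ha =>
    stableLimit_eq (fun m hm => (hle n m hm).eq_of_mem a ha) hf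
  refine ⟨h, ?_, ?_, ?_, ?_, ?_⟩
  · intro x hx
    obtain ⟨n, rfl⟩ := he ▸ hx
    rw [hA (n + 1) _ (hs n).2.1]
    exact (s (n + 1)).2.map_mem _ (hs n).2.1
  · intro y hy
    obtain ⟨n, rfl⟩ := he ▸ hy
    obtain ⟨a, ha, hay⟩ := (hs n).2.2
    rw [← hay, ← hA (n + 1) a ha, h.symm_apply_apply]
    exact (s (n + 1)).2.subset ha
  · intro x hx
    obtain ⟨n, rfl⟩ := he ▸ hx
    rw [hA (n + 1) _ (hs n).2.1]
    exact (s (n + 1)).2.mem_iff _ (hs n).2.1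
  · intro n x hx
    have : h x = (s n).1.1 x := stableLimit_eq (fun m hm => (hle n m hm).eq_of_notMem x hx) hf
    rw [this]
    exact (s n).2.tailEquiv x fun hxA => hx (hDO n ((s n).2.subset hxA))
  · intro n y hy
    have : h.symm y = (s n).1.1.symm y :=
      stableLimit_eq (fun m hm => (hle n m hm).symm_eq_of_notMem y hy) hg
    rw [this]
    exact (s n).2.symm.tailEquiv y fun hyA => hy (hDO n ((s n).2.symm.subset hyA))

/-- An uncountable saturated λ-set `X ⊆ 2^ω` is relatively CDH in `2^ω`: for all
countable dense (in `X`) subsets `D₀, D₁` of `X` there is a homeomorphism of `2^ω`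
mapping `D₀` onto `D₁` and `X` onto `X`. -/
theorem relatively_CDH_of_saturated_lambda (X : Set Cantor)
    (hunc : ¬ X.Countable) (hsat : Saturated X) (hlam : IsLambdaSet X)
    (D₀ D₁ : Set Cantor) (hD₀X : D₀ ⊆ X) (hD₁X : D₁ ⊆ X)
    (hD₀c : D₀.Countable) (hD₁c : D₁.Countable)
    (hD₀d : X ⊆ closure D₀) (hD₁d : X ⊆ closure D₁) :
    ∃ h : Cantor ≃ₜ Cantor, h '' D₀ = D₁ ∧ h '' X = X := by
  obtain ⟨z, hzX, hz⟩ : ∃ z ∈ X, z ∉ saturation (D₀ ∪ D₁) := by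
    by_contra! hcon
    exact hunc ((countable_saturation (hD₀c.union hD₁c)).mono hcon)
  have hXd : Dense X := hsat.dense ⟨z, hzX⟩
  have hd₀ : Dense D₀ := dense_closure.1 (hXd.mono hD₀d)
  have hd₁ : Dense D₁ := dense_closure.1 (hXd.mono hD₁d)
  set D := saturation (insert z (D₀ ∪ D₁))
  have hsub : insert z (D₀ ∪ D₁) ⊆ D := subset_saturation _
  have hD₀ : D₀ ⊆ D := fun x hx => hsub (.inr (.inl hx))
  have hD₁ : D₁ ⊆ D := fun x hx => hsub (.inr (.inr hx))
  have hDX : D ⊆ X := by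
    rintro y ⟨x, hx, hyx⟩
    exact hsat.mem_of_tailEquiv (insert_subset hzX (union_subset hD₀X hD₁X) hx) hyx
  have hDc : D.Countable := countable_saturation ((hD₀c.union hD₁c).insert z)
  have hzD : ∀ y, TailEquiv y z → y ∈ D ∧ y ∉ D₀ ∪ D₁ := fun y hy =>
    ⟨⟨z, mem_insert _ _, hy⟩, fun hyD => hz ⟨y, hyD, hy.symm⟩⟩
  have hd₀' : Dense (D \ D₀) :=
    (dense_tailClass z).mono fun y hy => ⟨(hzD y hy).1, fun h => (hzD y hy).2 (.inl h)⟩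
  have hd₁' : Dense (D \ D₁) :=
    (dense_tailClass z).mono fun y hy => ⟨(hzD y hy).1, fun h => (hzD y hy).2 (.inr h)⟩
  obtain ⟨G, hG, hGX⟩ := hlam D hDX hDc
  obtain ⟨U, hU, rfl⟩ := isGδ_iff_eq_iInter_nat.1 hG
  have hDU : ∀ n, D ⊆ U n := fun n x hx => mem_iInter.1 ((hGX ▸ hx : x ∈ _ ∩ X).1) n
  obtain ⟨h, h₁, h₂, h₃, h₄, h₅⟩ := exists_homeomorph_of_matching hDc ⟨z, hsub (mem_insert _ _)⟩
    (fun x hx y hyx => mem_saturation_of_tailEquiv hx hyx) hD₀ hD₁ hd₀ hd₀' hd₁ hd₁'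
    (O := fun n => ⋂ i ∈ Iic n, U i)
    (fun n => (finite_Iic n).isOpen_biInter fun i _ => hU i)
    (fun m n hmn => biInter_subset_biInter_left (Iic_subset_Iic.2 hmn))
    (fun n => subset_iInter₂ fun i _ => hDU i)
  have hout : ∀ x ∈ X, x ∉ D → ∃ n, x ∉ ⋂ i ∈ Iic n, U i := by
    intro x hx hxD
    by_contra! hcon
    refine hxD (hGX ▸ ⟨mem_iInter.2 fun n => ?_, hx⟩)
    exact mem_iInter₂.1 (hcon n) n self_mem_Iic
  have hX : ∀ x ∈ X, h x ∈ X := by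
    intro x hx
    by_cases hxD : x ∈ D
    · exact hDX (h₁ x hxD)
    · obtain ⟨n, hn⟩ := hout x hx hxD
      exact hsat.mem_of_tailEquiv hx (h₄ n x hn)
  have hX' : ∀ y ∈ X, h.symm y ∈ X := by
    intro y hy
    by_cases hyD : y ∈ D
    · exact hDX (h₂ y hyD)
    · obtain ⟨n, hn⟩ := hout y hy hyD
      exact hsat.mem_of_tailEquiv hy (h₅ n y hn)
  refine ⟨h, ?_, ?_⟩
  · refine Subset.antisymm ?_ fun y hy => ?_
    · rintro _ ⟨x, hx, rfl⟩
      exact (h₃ x (hD₀ hx)).1 hx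
    · exact ⟨h.symm y, (h₃ _ (h₂ y (hD₁ hy))).2 (by simpa using hy), by simp⟩
  · refine Subset.antisymm (image_subset_iff.2 hX) fun y hy => ⟨h.symm y, hX' y hy, by simp⟩
end

section
/- For every uncountable cardinal κ ≤ 𝔠, the following are equivalent: (1) there exists a separable metrizable CDH space of cardinality κ that is meager in itself; (2) there exists a λ-set of cardinality κ. -/
open Set TopologicalSpace

/-! ### Cylinders -/

/-- The set of points whose code under `e` agrees with that of `x` in the first `n` places. -/
def cylinderSet {X : Type*} (e : X → ℕ → Bool) (n : ℕ) (x : X) : Set X :=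
  {y | ∀ k < n, e y k = e x k}

section Cylinder

variable {X : Type*} {e : X → ℕ → Bool} {n m : ℕ} {x y z : X}

theorem mem_cylinderSet_self (e : X → ℕ → Bool) (n : ℕ) (x : X) : x ∈ cylinderSet e n x :=
  fun _ _ => rfl

theorem cylinderSet_eq_of_mem (h : y ∈ cylinderSet e n x) :
    cylinderSet e n y = cylinderSet e n x := by
  ext z
  exact ⟨fun hz k hk => (hz k hk).trans (h k hk), fun hz k hk => (hz k hk).trans (h k hk).symm⟩

theorem mem_cylinderSet_comm : y ∈ cylinderSet e n x ↔ x ∈ cylinderSet e n y :=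
  ⟨fun h k hk => (h k hk).symm, fun h k hk => (h k hk).symm⟩

theorem cylinderSet_anti (h : n ≤ m) : cylinderSet e m x ⊆ cylinderSet e n x :=
  fun _ hy k hk => hy k (hk.trans_le h)

theorem cylinderSet_zero : cylinderSet e 0 x = univ := by
  ext y; simp [cylinderSet]

theorem finite_range_cylinderSet (e : X → ℕ → Bool) (n : ℕ) :
    (range (cylinderSet e n)).Finite := by
  have : range (cylinderSet e n) ⊆
      range (fun s : Fin n → Bool => {y : X | ∀ k : Fin n, e y k = s k}) := by
    rintro _ ⟨x, rfl⟩
    refine ⟨fun k => e x k, ?_⟩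
    ext y
    exact ⟨fun h k hk => h ⟨k, hk⟩, fun h k => h k k.2⟩
  exact (finite_range _).subset this

theorem eq_of_forall_mem_cylinderSet (he : Function.Injective e)
    (h : ∀ n, y ∈ cylinderSet e n x) : y = x :=
  he (funext fun k => h (k + 1) k k.lt_succ_self)

variable [TopologicalSpace X]

theorem isClopen_cylinderSet (he : Continuous e) (n : ℕ) (x : X) :
    IsClopen (cylinderSet e n x) := by
  have : cylinderSet e n x = ⋂ k ∈ Finset.range n, (fun y => e y k) ⁻¹' {e x k} := by
    ext y; simp [cylinderSet]
  rw [this]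
  refine isClopen_biInter_finset fun k _ => ?_
  exact (isClopen_discrete _).preimage ((continuous_apply k).comp he)

theorem cylinderSet_mem_nhds (he : Continuous e) (n : ℕ) (x : X) :
    cylinderSet e n x ∈ nhds x :=
  (isClopen_cylinderSet he n x).isOpen.mem_nhds (mem_cylinderSet_self e n x)

theorem exists_cylinderSet_subset (he : Topology.IsInducing e) {s : Set X} (hs : s ∈ nhds x) :
    ∃ n, cylinderSet e n x ⊆ s := by
  rw [he.nhds_eq_comap, Filter.mem_comap] at hs
  obtain ⟨t, ht, hts⟩ := hs
  rw [nhds_pi, Filter.mem_pi] at ht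
  obtain ⟨I, hI, u, hu, hut⟩ := ht
  obtain ⟨N, hN⟩ := hI.bddAbove
  refine ⟨N + 1, fun y hy => hts (hut fun k hk => ?_)⟩
  have : e y k = e x k := hy k (Nat.lt_succ_of_le (hN hk))
  rw [this]
  exact mem_of_mem_nhds (hu k)

theorem tendsto_of_eventually_mem_cylinderSet (he : Topology.IsInducing e) {α : Type*}
    {l : Filter α} {f : α → X} (h : ∀ n, ∀ᶠ a in l, f a ∈ cylinderSet e n x) :
    Filter.Tendsto f l (nhds x) := by
  intro s hs
  obtain ⟨n, hn⟩ := exists_cylinderSet_subset he hs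
  exact (h n).mono fun a ha => hn ha

end Cylinder

/-! ### The Whitney partition of the complement of a closed set -/

/-- The classes of this relation are the points of the closed set `K` and the maximal cylinders
disjoint from `K`. -/
def WhitneyRel {X : Type*} (e : X → ℕ → Bool) (K : Set X) (x y : X) : Prop :=
  ∀ n, (∀ m < n, (cylinderSet e m x ∩ K).Nonempty) → y ∈ cylinderSet e n x

section Whitney

variable {X : Type*} {e : X → ℕ → Bool} {K K' : Set X} {x y z : X}

theorem WhitneyRel.refl (e : X → ℕ → Bool) (K : Set X) (x : X) : WhitneyRel e K x x :=
  fun n _ => mem_cylinderSet_self e n x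

theorem WhitneyRel.forall_nonempty (h : WhitneyRel e K x y) (n : ℕ)
    (hy : ∀ m < n, (cylinderSet e m y ∩ K).Nonempty) :
    ∀ m < n, (cylinderSet e m x ∩ K).Nonempty := by
  intro m
  induction m using Nat.strong_induction_on with
  | _ m ih =>
    intro hm
    have := h m fun k hk => ih k hk (hk.trans hm)
    rw [← cylinderSet_eq_of_mem this]
    exact hy m hm

theorem WhitneyRel.symm (h : WhitneyRel e K x y) : WhitneyRel e K y x := by
  intro n hn
  exact mem_cylinderSet_comm.1 (h n (h.forall_nonempty n hn))

theorem WhitneyRel.trans (h : WhitneyRel e K x y) (h' : WhitneyRel e K y z) :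
    WhitneyRel e K x z := by
  intro n hn
  have h1 := h n hn
  rw [← cylinderSet_eq_of_mem h1]
  exact h' n (h.symm.forall_nonempty n hn)

theorem WhitneyRel.mono (hK : K ⊆ K') (h : WhitneyRel e K' x y) : WhitneyRel e K x y :=
  fun n hn => h n fun m hm => (hn m hm).mono (inter_subset_inter_right _ hK)

theorem WhitneyRel.mem_cylinderSet (h : WhitneyRel e K y z) (hx : x ∈ K) {n : ℕ}
    (hy : y ∈ cylinderSet e n x) : z ∈ cylinderSet e n x := by
  rw [← cylinderSet_eq_of_mem hy]
  exact h n fun m hm => ⟨x, mem_cylinderSet_comm.1 (cylinderSet_anti hm.le hy), hx⟩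

theorem WhitneyRel.eq_of_mem (he : Function.Injective e) (hx : x ∈ K) (h : WhitneyRel e K x y) :
    y = x :=
  eq_of_forall_mem_cylinderSet he fun n => h.mem_cylinderSet hx (mem_cylinderSet_self e n x)

variable [TopologicalSpace X]

theorem exists_whitneyRel_eq_cylinderSet (he : Topology.IsInducing e) (hK : IsClosed K)
    (hx : x ∉ K) : ∃ n, {y | WhitneyRel e K x y} = cylinderSet e n x ∧
      Disjoint (cylinderSet e n x) K ∧ ∀ m < n, (cylinderSet e m x ∩ K).Nonempty := by
  classical
  have hex : ∃ n, Disjoint (cylinderSet e n x) K := by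
    obtain ⟨n, hn⟩ := exists_cylinderSet_subset he (hK.isOpen_compl.mem_nhds hx)
    exact ⟨n, disjoint_left.2 fun y hy => hn hy⟩
  have hmin : ∀ m < Nat.find hex, (cylinderSet e m x ∩ K).Nonempty := fun m hm =>
    not_disjoint_iff_nonempty_inter.1 (Nat.find_min hex hm)
  refine ⟨Nat.find hex, ?_, Nat.find_spec hex, hmin⟩
  ext y
  refine ⟨fun h => h _ hmin, fun h n hn => ?_⟩
  refine cylinderSet_anti (not_lt.1 fun hlt => ?_) h
  exact not_disjoint_iff_nonempty_inter.2 (hn _ hlt) (Nat.find_spec hex)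

theorem isClopen_whitneyRel (he : Topology.IsInducing e) (hK : IsClosed K) (hx : x ∉ K) :
    IsClopen {y | WhitneyRel e K x y} := by
  obtain ⟨n, hn, -⟩ := exists_whitneyRel_eq_cylinderSet he hK hx
  exact hn ▸ isClopen_cylinderSet he.continuous n x

theorem continuousAt_of_whitneyRel (he : Topology.IsEmbedding e) {g : X → X}
    (hg : ∀ y, WhitneyRel e K y (g y)) (hx : x ∈ K) : ContinuousAt g x := by
  have hgx : g x = x := (hg x).eq_of_mem he.injective hx
  refine tendsto_of_eventually_mem_cylinderSet he.isInducing fun n => ?_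
  filter_upwards [cylinderSet_mem_nhds he.continuous n x] with y hy
  rw [hgx]
  exact (hg y).mem_cylinderSet hx hy

/-! ### Limits of homeomorphisms -/

theorem exists_homeomorph_eqOn_iUnion (he : Topology.IsEmbedding e) {f : ℕ → X ≃ₜ X}
    {K : ℕ → Set X} (hK : Monotone K)
    (hf : ∀ n x, WhitneyRel e (K n) x ((f n).symm (f (n + 1) x)))
    (hdom : ⋃ n, K n = univ) (hrange : ⋃ n, f n '' K n = univ) :
    ∃ g : X ≃ₜ X, ∀ n, ∀ x ∈ K n, g x = f n x := by
  have hR : ∀ n k x, WhitneyRel e (K n) x ((f n).symm (f (n + k) x)) := by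
    intro n k
    induction k with
    | zero => intro x; simpa using WhitneyRel.refl e (K n) x
    | succ k ih =>
      intro x
      have h1 := (hf (n + k) x).mono (hK (Nat.le_add_right n k))
      have h2 := ih ((f (n + k)).symm (f (n + k + 1) x))
      rw [Homeomorph.apply_symm_apply] at h2
      exact h1.trans h2
  have hstab : ∀ n m, n ≤ m → ∀ x ∈ K n, f m x = f n x := by
    intro n m hnm x hx
    obtain ⟨k, rfl⟩ := Nat.exists_eq_add_of_le hnm
    have := (hR n k x).eq_of_mem he.injective hx
    rw [← this, Homeomorph.apply_symm_apply, this]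
  have hex : ∀ x, ∃ n, x ∈ K n := fun x => mem_iUnion.1 (hdom ▸ mem_univ x)
  choose N hN using hex
  set g : X → X := fun x => f (N x) x with hgdef
  have hg : ∀ n, ∀ x ∈ K n, g x = f n x := by
    intro n x hx
    rcases le_total n (N x) with h | h
    · exact hstab _ _ h x hx
    · exact (hstab _ _ h x (hN x)).symm
  have hgR : ∀ n x, WhitneyRel e (K n) x ((f n).symm (g x)) := by
    intro n x
    rcases le_total n (N x) with h | h
    · obtain ⟨k, hk⟩ := Nat.exists_eq_add_of_le h
      have := hR n k x
      rwa [← hk] at this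
    · rw [hg n x (hK h (hN x)), Homeomorph.symm_apply_apply]
      exact WhitneyRel.refl _ _ _
  have hinj : Function.Injective g := by
    intro x y hxy
    have hx := hK (le_max_left (N x) (N y)) (hN x)
    have hy := hK (le_max_right (N x) (N y)) (hN y)
    rw [hg _ x hx, hg _ y hy] at hxy
    exact (f _).injective hxy
  have hsurj : Function.Surjective g := by
    intro y
    obtain ⟨n, x, hx, rfl⟩ := mem_iUnion.1 (hrange ▸ mem_univ y)
    exact ⟨x, hg n x hx⟩
  let G : X ≃ X := Equiv.ofBijective g ⟨hinj, hsurj⟩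
  have hcont : Continuous G := by
    refine continuous_iff_continuousAt.2 fun x => ?_
    have h1 : ContinuousAt (fun y => (f (N x)).symm (g y)) x :=
      continuousAt_of_whitneyRel he (hgR (N x)) (hN x)
    have h2 := (f (N x)).continuous.continuousAt.comp h1
    have h3 : ContinuousAt g x := by simpa [Function.comp_def] using h2
    exact h3
  have hsymm : Continuous G.symm := by
    refine continuous_iff_continuousAt.2 fun y => ?_
    obtain ⟨x, rfl⟩ := G.surjective y
    set n := N x
    have h1 : ContinuousAt (fun y => G.symm (f n y)) x := by
      refine continuousAt_of_whitneyRel he (fun y => ?_) (hN x)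
      have := hgR n (G.symm (f n y))
      have hG : g (G.symm (f n y)) = f n y := G.apply_symm_apply _
      rw [hG, Homeomorph.symm_apply_apply] at this
      exact this.symm
    have hx : (f n).symm (G x) = x := by
      rw [Homeomorph.symm_apply_eq]; exact hg n x (hN x)
    have h2 : ContinuousAt (fun y => G.symm (f n y)) ((f n).symm (G x)) := hx.symm ▸ h1
    have h3 := h2.comp ((f n).symm.continuous.continuousAt (x := G x))
    simpa [Function.comp_def] using h3
  exact ⟨⟨G, hcont, hsymm⟩, hg⟩

end Whitney

/-! ### Gluing bijections along partitions -/

theorem bijective_sumElim_sigma {X ι : Type*} {T : Set X} {U : ι → Set X}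
    (hU : Pairwise (Function.onFun Disjoint U)) (hUT : ⋃ i, U i = Tᶜ) :
    Function.Bijective
      (Sum.elim (fun t : T => (t : X)) (fun p : Σ i, U i => (p.2 : X))) := by
  have hmem : ∀ i, ∀ x ∈ U i, x ∉ T := fun i x hx => by
    have : x ∈ Tᶜ := hUT ▸ mem_iUnion.2 ⟨i, hx⟩
    exact this
  constructor
  · rintro (⟨x, hx⟩ | ⟨i, x, hx⟩) (⟨y, hy⟩ | ⟨j, y, hy⟩) hxy <;>
      simp only [Sum.elim_inl, Sum.elim_inr] at hxy <;> subst hxy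
    · rfl
    · exact absurd hx (hmem j _ hy)
    · exact absurd hy (hmem i _ hx)
    · have : i = j := by
        by_contra hij
        exact disjoint_left.1 (hU hij) hx hy
      subst this
      rfl
  · intro x
    by_cases hx : x ∈ T
    · exact ⟨Sum.inl ⟨x, hx⟩, rfl⟩
    · obtain ⟨i, hi⟩ := mem_iUnion.1 (hUT ▸ (show x ∈ Tᶜ from hx) : x ∈ ⋃ i, U i)
      exact ⟨Sum.inr ⟨i, x, hi⟩, rfl⟩

theorem exists_equiv_glue {X ι : Type*} {T L : Set X} {U V : ι → Set X}
    (hU : Pairwise (Function.onFun Disjoint U)) (hUT : ⋃ i, U i = Tᶜ)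
    (hV : Pairwise (Function.onFun Disjoint V)) (hVL : ⋃ i, V i = Lᶜ)
    (h : T ≃ L) (θ : ∀ i, U i ≃ V i) :
    ∃ φ : X ≃ X, (∀ t : T, φ t = h t) ∧ ∀ i (u : U i), φ u = θ i u := by
  let p := Equiv.ofBijective _ (bijective_sumElim_sigma hU hUT)
  let q := Equiv.ofBijective _ (bijective_sumElim_sigma hV hVL)
  refine ⟨p.symm.trans ((Equiv.sumCongr h (Equiv.sigmaCongrRight θ)).trans q), ?_, ?_⟩
  · intro t
    have : p.symm t = Sum.inl t := by rw [Equiv.symm_apply_eq]; rfl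
    simp only [Equiv.trans_apply, this]
    rfl
  · intro i u
    have : p.symm u = Sum.inr ⟨i, u⟩ := by rw [Equiv.symm_apply_eq]; rfl
    simp only [Equiv.trans_apply, this]
    rfl

theorem continuousAt_of_eq_on_isOpen {X Y : Type*} [TopologicalSpace X] [TopologicalSpace Y]
    {U : Set X} (hU : IsOpen U) {f : X → Y} {g : U → Y} (hg : Continuous g)
    (hfg : ∀ u : U, f u = g u) {x : X} (hx : x ∈ U) : ContinuousAt f x := by
  have h : ContinuousOn f U :=
    continuousOn_iff_continuous_domRestrict.2 (hg.congr fun u => (hfg u).symm)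
  exact h.continuousAt (hU.mem_nhds hx)

/-! ### Extending homeomorphisms between closed nowhere dense sets -/

/-- A partition of the complement of `T` into nonempty clopen sets converging to `T`. -/
structure IsWhitneySeq {X : Type*} [TopologicalSpace X] (e : X → ℕ → Bool) (T : Set X)
    (U : ℕ → Set X) (a : ℕ → T) : Prop where
  isClopen : ∀ i, IsClopen (U i)
  nonempty : ∀ i, (U i).Nonempty
  disjoint : Pairwise (Function.onFun Disjoint U)
  iUnion_eq : ⋃ i, U i = Tᶜ
  subset_cylinderSet : ∀ n, ∀ᶠ i in Filter.atTop, U i ⊆ cylinderSet e n (a i)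

section KnasterReichbach

variable {X : Type*} [TopologicalSpace X] {e : X → ℕ → Bool}

theorem exists_isWhitneySeq [SecondCountableTopology X] (he : Topology.IsEmbedding e)
    {T : Set X} (hT : IsClosed T) (hT0 : interior T = ∅) (hTne : T.Nonempty) :
    ∃ U a, IsWhitneySeq e T U a := by
  set S : Set (Set X) := (fun x => {y | WhitneyRel e T x y}) '' Tᶜ with hS
  have hdisj : S.PairwiseDisjoint id := by
    rintro _ ⟨x, hx, rfl⟩ _ ⟨y, hy, rfl⟩ hxy
    refine disjoint_left.2 fun z hz hz' => hxy ?_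
    ext w
    exact ⟨fun hw => hz'.trans (hz.symm.trans hw), fun hw => hz.trans (hz'.symm.trans hw)⟩
  have hclopen : ∀ s ∈ S, IsClopen s := by
    rintro _ ⟨x, hx, rfl⟩
    exact isClopen_whitneyRel he.isInducing hT hx
  have hne : ∀ s ∈ S, s.Nonempty := by
    rintro _ ⟨x, hx, rfl⟩
    exact ⟨x, WhitneyRel.refl e T x⟩
  have hunion : ⋃₀ S = Tᶜ := by
    refine Subset.antisymm ?_ fun x hx => ⟨_, ⟨x, hx, rfl⟩, WhitneyRel.refl e T x⟩
    rintro y ⟨_, ⟨x, hx, rfl⟩, hy⟩ hyT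
    have hxy := hy.symm.eq_of_mem he.injective hyT
    exact hx (hxy ▸ hyT)
  have hcount : S.Countable :=
    hdisj.countable_of_isOpen (fun s hs => (hclopen s hs).isOpen) hne
  have hinf : S.Infinite := by
    intro hfin
    have h1 : IsClosed Tᶜ := by
      rw [← hunion, sUnion_eq_biUnion]
      exact hfin.isClosed_biUnion fun s hs => (hclopen s hs).isClosed
    have h2 : IsOpen T := isClosed_compl_iff.1 h1
    rw [h2.interior_eq] at hT0
    exact hTne.ne_empty hT0
  have hlev : ∀ s : S, ∃ (n : ℕ) (a : T), (s : Set X) ∈ range (cylinderSet e (n + 1)) ∧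
      (s : Set X) ⊆ cylinderSet e n a := by
    rintro ⟨_, x, hx, rfl⟩
    obtain ⟨n, hn, hd, hm⟩ := exists_whitneyRel_eq_cylinderSet he.isInducing hT hx
    cases n with
    | zero =>
      rw [cylinderSet_zero] at hd
      exact absurd hTne (by simp [univ_disjoint.1 hd])
    | succ n =>
      obtain ⟨a, ha, haT⟩ := hm n n.lt_succ_self
      refine ⟨n, ⟨a, haT⟩, ⟨x, hn.symm⟩, ?_⟩
      rw [cylinderSet_eq_of_mem ha]
      change {y | WhitneyRel e T x y} ⊆ _
      rw [hn]
      exact cylinderSet_anti n.le_succ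
  choose lev a hrange hsub using hlev
  have hfinlev : ∀ n, {s : S | lev s < n}.Finite := by
    intro n
    refine Finite.of_finite_image (f := fun s : S => (s : Set X)) ?_ Subtype.val_injective.injOn
    refine ((finite_lt_nat n).biUnion fun k _ => finite_range_cylinderSet e (k + 1)).subset ?_
    rintro _ ⟨s, hs, rfl⟩
    exact mem_biUnion hs (hrange s)
  have : Infinite S := hinf.to_subtype
  have : Countable S := hcount.to_subtype
  obtain ⟨E⟩ : Nonempty (ℕ ≃ S) := nonempty_equiv_of_countable
  refine ⟨fun i => E i, fun i => a (E i), ⟨fun i => hclopen _ (E i).2, fun i => hne _ (E i).2,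
    ?_, ?_, ?_⟩⟩
  · intro i j hij
    exact hdisj (E i).2 (E j).2 fun h => hij (E.injective (Subtype.ext h))
  · rw [← hunion, sUnion_eq_iUnion]
    exact E.surjective.iUnion_comp (fun s : S => (s : Set X))
  · intro n
    have h1 : {i | lev (E i) < n}.Finite := (hfinlev n).preimage E.injective.injOn
    have h2 : ∀ᶠ i in Filter.cofinite, ¬ lev (E i) < n := h1.eventually_cofinite_notMem
    rw [Nat.cofinite_eq_atTop] at h2
    filter_upwards [h2] with i hi
    exact (hsub (E i)).trans (cylinderSet_anti (not_lt.1 hi))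

theorem IsWhitneySeq.frequently_subset_cylinderSet (he : Continuous e) {T : Set X}
    {U : ℕ → Set X} {a : ℕ → T} (h : IsWhitneySeq e T U a) (hT0 : interior T = ∅) {x : X}
    (hx : x ∈ T) (n : ℕ) : ∃ᶠ i in Filter.atTop, U i ⊆ cylinderSet e n x := by
  rw [Filter.frequently_atTop]
  intro N
  obtain ⟨M, hM⟩ := Filter.eventually_atTop.1 (h.subset_cylinderSet n)
  set O : Set X := cylinderSet e n x ∩ ⋂ i ∈ Finset.range (max N M), (U i)ᶜ
  have hO : IsOpen O := (isClopen_cylinderSet he n x).isOpen.inter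
    (isOpen_biInter_finset fun i _ => (h.isClopen i).compl.isOpen)
  have hxO : x ∈ O := by
    refine ⟨mem_cylinderSet_self e n x, mem_iInter₂.2 fun i _ hi => ?_⟩
    have : x ∈ Tᶜ := h.iUnion_eq ▸ mem_iUnion.2 ⟨i, hi⟩
    exact this hx
  have hsub : ¬ O ⊆ T := by
    intro hOT
    have := (interior_maximal hOT hO) hxO
    rw [hT0] at this
    exact this
  obtain ⟨y, hyO, hyT⟩ := not_subset.1 hsub
  obtain ⟨i, hi⟩ := mem_iUnion.1 (h.iUnion_eq ▸ (show y ∈ Tᶜ from hyT) : y ∈ ⋃ i, U i)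
  have hiN : max N M ≤ i := by
    by_contra hlt
    exact mem_iInter₂.1 hyO.2 i (Finset.mem_range.2 (not_le.1 hlt)) hi
  refine ⟨i, (le_max_left _ _).trans hiN, ?_⟩
  have h1 := hM i ((le_max_right _ _).trans hiN)
  have h2 : cylinderSet e n (a i : X) = cylinderSet e n x := by
    rw [← cylinderSet_eq_of_mem (h1 hi), cylinderSet_eq_of_mem hyO.1]
  exact h2 ▸ h1

theorem IsWhitneySeq.continuousAt (he : Topology.IsEmbedding e) {T L : Set X}
    {U V : ℕ → Set X} {a : ℕ → T} {b : ℕ → L} (hU : IsWhitneySeq e T U a)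
    (hV : IsWhitneySeq e L V b) (h : T ≃ₜ L) (σ : ℕ ≃ ℕ)
    (hσ : ∀ i, V (σ i) ⊆ cylinderSet e i (h (a i)) ∨
      U i ⊆ cylinderSet e (σ i) (h.symm (b (σ i))))
    {φ : X → X} (hφT : ∀ t : T, φ t = h t) (hφU : ∀ i, ∀ u ∈ U i, φ u ∈ V (σ i)) (x : T) :
    ContinuousAt φ x := by
  refine tendsto_of_eventually_mem_cylinderSet he.isInducing fun n => ?_
  have h1 : (fun t : T => (h t : X)) ⁻¹' cylinderSet e n (h x) ∈ nhds x :=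
    (continuous_subtype_val.comp h.continuous).continuousAt
      (cylinderSet_mem_nhds he.continuous n _)
  rw [nhds_subtype, Filter.mem_comap] at h1
  obtain ⟨s, hs, hsn⟩ := h1
  obtain ⟨m, hm⟩ := exists_cylinderSet_subset he.isInducing hs
  have hkey : ∀ t : T, (t : X) ∈ cylinderSet e m x → (h t : X) ∈ cylinderSet e n (h x) :=
    fun t ht => hsn (hm ht)
  have hσlim : Filter.Tendsto σ Filter.atTop Filter.atTop := by
    rw [← Nat.cofinite_eq_atTop]; exact σ.injective.tendsto_cofinite
  obtain ⟨N, hN⟩ := Filter.eventually_atTop.1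
    ((hU.subset_cylinderSet m).and ((hσlim.eventually (hV.subset_cylinderSet n)).and
      ((Filter.eventually_ge_atTop n).and (hσlim.eventually (Filter.eventually_ge_atTop m)))))
  have hO : ⋂ i ∈ Finset.range N, (U i)ᶜ ∈ nhds (x : X) := by
    refine (isOpen_biInter_finset fun i _ => (hU.isClopen i).compl.isOpen).mem_nhds ?_
    refine mem_iInter₂.2 fun i _ hi => ?_
    have : (x : X) ∈ Tᶜ := hU.iUnion_eq ▸ mem_iUnion.2 ⟨i, hi⟩
    exact this x.2
  filter_upwards [hO, cylinderSet_mem_nhds he.continuous m (x : X)] with y hyO hy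
  rw [hφT]
  by_cases hyT : y ∈ T
  · have := hφT ⟨y, hyT⟩
    change φ y = _ at this
    rw [this]
    exact hkey ⟨y, hyT⟩ hy
  obtain ⟨i, hi⟩ := mem_iUnion.1 (hU.iUnion_eq ▸ (show y ∈ Tᶜ from hyT) : y ∈ ⋃ i, U i)
  have hiN : N ≤ i := by
    by_contra hlt
    exact mem_iInter₂.1 hyO i (Finset.mem_range.2 (not_le.1 hlt)) hi
  obtain ⟨g1, g2, g3, g4⟩ := hN i hiN
  have hφy := hφU i y hi
  rcases hσ i with hc | hc
  · have ha : (a i : X) ∈ cylinderSet e m x := by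
      rw [← cylinderSet_eq_of_mem hy]; exact mem_cylinderSet_comm.1 (g1 hi)
    rw [← cylinderSet_eq_of_mem (hkey _ ha)]
    exact cylinderSet_anti g3 (hc hφy)
  · have hb : (h.symm (b (σ i)) : X) ∈ cylinderSet e m x := by
      rw [← cylinderSet_eq_of_mem hy]
      exact mem_cylinderSet_comm.1 (cylinderSet_anti g4 (hc hi))
    have := hkey _ hb
    rw [Homeomorph.apply_symm_apply] at this
    rw [← cylinderSet_eq_of_mem this]
    exact g2 hφy

/-- A homeomorphism between closed nowhere dense sets extends to the whole space. -/
theorem exists_homeomorph_extend [SecondCountableTopology X] (he : Topology.IsEmbedding e)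
    (hX : ∀ U : Set X, IsClopen U → U.Nonempty → Nonempty (U ≃ₜ X))
    {T L : Set X} (hT : IsClosed T) (hT0 : interior T = ∅) (hL : IsClosed L)
    (hL0 : interior L = ∅) (hTne : T.Nonempty) (h : T ≃ₜ L) :
    ∃ φ : X ≃ₜ X, ∀ t : T, φ t = h t := by
  have hLne : L.Nonempty := ⟨_, (h ⟨_, hTne.some_mem⟩).2⟩
  obtain ⟨U, a, hU⟩ := exists_isWhitneySeq he hT hT0 hTne
  obtain ⟨V, b, hV⟩ := exists_isWhitneySeq he hL hL0 hLne
  obtain ⟨f, hf, hf'⟩ := Filter.extraction_forall_of_frequently fun i =>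
    hV.frequently_subset_cylinderSet he.continuous hL0 (h (a i)).2 i
  obtain ⟨g, hg, hg'⟩ := Filter.extraction_forall_of_frequently fun j =>
    hU.frequently_subset_cylinderSet he.continuous hT0 (h.symm (b j)).2 j
  obtain ⟨σ, hσ, hR⟩ := Function.Embedding.schroeder_bernstein_of_rel hf.injective hg.injective
    (fun i j => V j ⊆ cylinderSet e i (h (a i)) ∨ U i ⊆ cylinderSet e j (h.symm (b j)))
    (fun i => Or.inl (hf' i)) (fun j => Or.inr (hg' j))
  obtain ⟨σ, rfl⟩ : ∃ τ : ℕ ≃ ℕ, ⇑τ = σ := ⟨Equiv.ofBijective σ hσ, rfl⟩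
  have hθ : ∀ i, Nonempty (U i ≃ₜ V (σ i)) := fun i =>
    ⟨(hX _ (hU.isClopen i) (hU.nonempty i)).some.trans
      (hX _ (hV.isClopen _) (hV.nonempty _)).some.symm⟩
  let θ := fun i => (hθ i).some
  obtain ⟨φ, hφT, hφU⟩ := exists_equiv_glue hU.disjoint hU.iUnion_eq
    (V := fun i => V (σ i)) (fun i j hij => hV.disjoint (σ.injective.ne hij))
    ((σ.surjective.iUnion_comp V).trans hV.iUnion_eq) h.toEquiv (fun i => (θ i).toEquiv)
  have hφL : ∀ l : L, φ.symm l = h.symm l := by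
    intro l
    rw [Equiv.symm_apply_eq, hφT]
    simp
  have hφV : ∀ i (v : V (σ i)), φ.symm v = (θ i).symm v := by
    intro i v
    rw [Equiv.symm_apply_eq, hφU]
    simp
  have hc : Continuous φ := by
    refine continuous_iff_continuousAt.2 fun x => ?_
    by_cases hx : x ∈ T
    · refine hU.continuousAt he hV h σ hR hφT (fun i u hu => ?_) ⟨x, hx⟩
      rw [hφU i ⟨u, hu⟩]
      exact Subtype.coe_prop _
    · obtain ⟨i, hi⟩ := mem_iUnion.1 (hU.iUnion_eq ▸ (show x ∈ Tᶜ from hx) : x ∈ ⋃ i, U i)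
      exact continuousAt_of_eq_on_isOpen (hU.isClopen i).isOpen
        (continuous_subtype_val.comp (θ i).continuous) (hφU i) hi
  have hc' : Continuous φ.symm := by
    refine continuous_iff_continuousAt.2 fun x => ?_
    by_cases hx : x ∈ L
    · refine hV.continuousAt he hU h.symm σ.symm (fun j => ?_) hφL (fun j v hv => ?_) ⟨x, hx⟩
      · have := hR (σ.symm j)
        rw [Equiv.apply_symm_apply] at this
        exact this.symm
      · obtain ⟨i, rfl⟩ := σ.surjective j
        rw [hφV i ⟨v, hv⟩, Equiv.symm_apply_apply]
        exact Subtype.coe_prop _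
    · obtain ⟨j, hj⟩ := mem_iUnion.1 (hV.iUnion_eq ▸ (show x ∈ Lᶜ from hx) : x ∈ ⋃ i, V i)
      obtain ⟨i, rfl⟩ := σ.surjective j
      exact continuousAt_of_eq_on_isOpen (hV.isClopen (σ i)).isOpen
        (continuous_subtype_val.comp (θ i).symm.continuous) (hφV i) hj
  exact ⟨⟨φ, hc, hc'⟩, hφT⟩

end KnasterReichbach

/-! ### Back and forth -/

/-- A closed nowhere dense set which is disjoint from `D` or consists of a single point of `D`. -/
def IsAdapted {X : Type*} [TopologicalSpace X] (D A : Set X) : Prop :=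
  IsClosed A ∧ interior A = ∅ ∧ (Disjoint A D ∨ ∃ d ∈ D, A = {d})

theorem IsAdapted.preimage {X : Type*} [TopologicalSpace X] {D A : Set X} (h : IsAdapted D A)
    (f : X ≃ₜ X) : IsAdapted (f ⁻¹' D) (f ⁻¹' A) := by
  refine ⟨h.1.preimage f.continuous, ?_, ?_⟩
  · rw [← f.preimage_interior, h.2.1, preimage_empty]
  · rcases h.2.2 with h | ⟨d, hd, rfl⟩
    · exact Or.inl (h.preimage f)
    · refine Or.inr ⟨f.symm d, by simpa using hd, ?_⟩
      ext x
      simp [Homeomorph.eq_symm_apply]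

theorem exists_seq_isAdapted {X : Type*} [TopologicalSpace X] [T1Space X]
    (hpt : ∀ x : X, interior {x} = ∅) {D : Set X} (hD : D.Countable) (hdense : Dense D)
    (hGδ : IsGδ D) : ∃ A : ℕ → Set X, (∀ n, IsAdapted D (A n)) ∧ ⋃ n, A n = univ := by
  obtain ⟨O, hO, rfl⟩ := isGδ_iff_eq_iInter_nat.1 hGδ
  set D := ⋂ n, O n
  set S : Set (Set X) := range (fun n => (O n)ᶜ) ∪ singleton '' D
  have hS : S.Countable := (countable_range _).union (hD.image _)
  obtain ⟨A, hA⟩ := hS.exists_eq_range ⟨_, Or.inl ⟨0, rfl⟩⟩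
  refine ⟨A, fun n => ?_, ?_⟩
  · have : A n ∈ S := hA ▸ mem_range_self n
    rcases this with ⟨k, hk⟩ | ⟨d, hd, hk⟩
    · rw [← hk]
      refine ⟨(hO k).isClosed_compl, ?_, Or.inl ?_⟩
      · rw [interior_compl, (hdense.mono (iInter_subset O k)).closure_eq, compl_univ]
      · exact disjoint_compl_left_iff_subset.2 (iInter_subset O k)
    · rw [← hk]
      exact ⟨isClosed_singleton, hpt d, Or.inr ⟨d, hd, rfl⟩⟩
  · rw [← sUnion_range, ← hA]
    refine eq_univ_of_forall fun x => ?_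
    by_cases hx : x ∈ D
    · exact ⟨{x}, Or.inr ⟨x, hx, rfl⟩, rfl⟩
    · obtain ⟨n, hn⟩ := not_forall.1 (fun h => hx (mem_iInter.2 h))
      exact ⟨(O n)ᶜ, Or.inl ⟨n, rfl⟩, hn⟩

section BackAndForth

variable {X : Type*} [TopologicalSpace X] {e : X → ℕ → Bool}

theorem exists_homeomorph_clopen [SecondCountableTopology X] [T1Space X]
    (he : Topology.IsEmbedding e)
    (hX : ∀ U : Set X, IsClopen U → U.Nonempty → Nonempty (U ≃ₜ X))
    (hpt : ∀ x : X, interior {x} = ∅)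
    (hpush : ∀ E : Set X, E.Countable →
      ∃ j : X → X, Topology.IsClosedEmbedding j ∧ interior (range j) = ∅ ∧ Disjoint (range j) E)
    {D E A U : Set X} (hE : E.Countable) (hEd : Dense E) (hA : IsAdapted D A)
    (hU : IsClopen U) (hUne : U.Nonempty) :
    ∃ ψ : U ≃ₜ U, ∀ u : U, (u : X) ∈ A → ((u : X) ∈ D ↔ (ψ u : X) ∈ E) := by
  obtain ⟨θ⟩ := hX U hU hUne
  obtain ⟨hAc, hA0, hAD | ⟨d, hd, rfl⟩⟩ := hA
  · set ι : X → X := fun x => θ.symm x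
    have hι : Topology.IsOpenEmbedding ι :=
      hU.isOpen.isOpenEmbedding_subtypeVal.comp θ.symm.isOpenEmbedding
    suffices h : ∃ φ : X ≃ₜ X, ∀ x ∈ ι ⁻¹' A, φ x ∉ ι ⁻¹' E by
      obtain ⟨φ, hφ⟩ := h
      refine ⟨(θ.trans φ).trans θ.symm, fun u hu => ?_⟩
      have h1 := hφ (θ u) (by simpa [ι] using hu)
      exact iff_of_false (disjoint_left.1 hAD hu) h1
    rcases (ι ⁻¹' A).eq_empty_or_nonempty with h0 | hne
    · exact ⟨Homeomorph.refl X, by simp [h0]⟩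
    obtain ⟨j, hj, hj0, hjE⟩ := hpush (ι ⁻¹' E) (hE.preimage hι.injective)
    obtain ⟨φ, hφ⟩ := exists_homeomorph_extend he hX (T := ι ⁻¹' A) (L := j '' (ι ⁻¹' A))
      (hAc.preimage hι.continuous)
      (by rw [← hι.isOpenMap.preimage_interior_eq_interior_preimage hι.continuous, hA0,
        preimage_empty])
      (hj.isClosedMap _ (hAc.preimage hι.continuous))
      (subset_empty_iff.1 (hj0 ▸ interior_mono (image_subset_range _ _))) hne
      (hj.isEmbedding.homeomorphImage _)
    refine ⟨φ, fun x hx hxE => ?_⟩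
    have h1 := hφ ⟨x, hx⟩
    change φ x = _ at h1
    rw [h1] at hxE
    exact disjoint_left.1 hjE (image_subset_range _ _ (Subtype.coe_prop _)) hxE
  · by_cases hdU : d ∈ U
    · obtain ⟨c, hcU, hcE⟩ := hEd.inter_open_nonempty U hU.isOpen hUne
      have : Unique ({θ ⟨d, hdU⟩} : Set X) := uniqueSingleton _
      have : Unique ({θ ⟨c, hcU⟩} : Set X) := uniqueSingleton _
      obtain ⟨φ, hφ⟩ := exists_homeomorph_extend he hX (T := {θ ⟨d, hdU⟩}) (L := {θ ⟨c, hcU⟩})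
        isClosed_singleton (hpt _) isClosed_singleton (hpt _) (singleton_nonempty _)
        (Homeomorph.homeomorphOfUnique _ _)
      refine ⟨(θ.trans φ).trans θ.symm, fun u hu => ?_⟩
      have h1 : φ (θ ⟨d, hdU⟩) = θ ⟨c, hcU⟩ :=
        (hφ ⟨_, rfl⟩).trans (mem_singleton_iff.1 (Subtype.coe_prop _))
      have h2 : u = ⟨d, hdU⟩ := Subtype.ext hu
      subst h2
      simp [h1, hd, hcE]
    · exact ⟨Homeomorph.refl U, fun u hu => absurd u.2 (by rw [mem_singleton_iff.1 hu]; exact hdU)⟩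

theorem exists_homeomorph_whitneyRel (he : Topology.IsEmbedding e) {K A : Set X}
    {P : X → X → Prop} (hK : IsClosed K)
    (h : ∀ U : Set X, IsClopen U → U.Nonempty →
      ∃ ψ : U ≃ₜ U, ∀ u : U, (u : X) ∈ A → P u (ψ u)) :
    ∃ g : X ≃ₜ X, (∀ x, WhitneyRel e K x (g x)) ∧ ∀ x ∈ A, x ∉ K → P x (g x) := by
  set S : Set (Set X) := (fun x => {y | WhitneyRel e K x y}) '' Kᶜ with hS
  have hclopen : ∀ s : S, IsClopen (s : Set X) := by
    rintro ⟨_, x, hx, rfl⟩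
    exact isClopen_whitneyRel he.isInducing hK hx
  have hne : ∀ s : S, (s : Set X).Nonempty := by
    rintro ⟨_, x, hx, rfl⟩
    exact ⟨x, WhitneyRel.refl e K x⟩
  have hrel : ∀ s : S, ∀ y ∈ (s : Set X), ∀ z ∈ (s : Set X), WhitneyRel e K y z := by
    rintro ⟨_, x, hx, rfl⟩ y hy z hz
    exact (WhitneyRel.symm hy).trans hz
  have hdisj : Pairwise (Function.onFun Disjoint (fun s : S => (s : Set X))) := by
    rintro ⟨_, x, hx, rfl⟩ ⟨_, y, hy, rfl⟩ hxy
    refine disjoint_left.2 fun z hz hz' => hxy (Subtype.ext ?_)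
    ext w
    exact ⟨fun hw => hz'.trans (hz.symm.trans hw), fun hw => hz.trans (hz'.symm.trans hw)⟩
  have hunion : ⋃ s : S, (s : Set X) = Kᶜ := by
    refine Subset.antisymm (iUnion_subset ?_) fun x hx =>
      mem_iUnion.2 ⟨⟨_, x, hx, rfl⟩, WhitneyRel.refl e K x⟩
    rintro ⟨_, x, hx, rfl⟩ y hy hyK
    have hxy := (WhitneyRel.symm hy).eq_of_mem he.injective hyK
    exact hx (hxy ▸ hyK)
  choose ψ hψ using fun s : S => h s (hclopen s) (hne s)
  obtain ⟨φ, hφK, hφS⟩ := exists_equiv_glue hdisj hunion hdisj hunion (Equiv.refl K)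
    (fun s => (ψ s).toEquiv)
  have hcases : ∀ x, x ∈ K ∨ ∃ s : S, x ∈ (s : Set X) := by
    intro x
    by_cases hx : x ∈ K
    · exact Or.inl hx
    · exact Or.inr (mem_iUnion.1 (hunion ▸ (show x ∈ Kᶜ from hx) : x ∈ ⋃ s : S, (s : Set X)))
  have hφR : ∀ x, WhitneyRel e K x (φ x) := by
    intro x
    rcases hcases x with hx | ⟨s, hs⟩
    · have : φ x = x := hφK ⟨x, hx⟩
      rw [this]
      exact WhitneyRel.refl e K x
    · refine hrel s x hs _ ?_
      rw [hφS s ⟨x, hs⟩]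
      exact Subtype.coe_prop _
  have hφV : ∀ (s : S) (v : (s : Set X)), φ.symm v = (ψ s).symm v := by
    intro s v
    rw [Equiv.symm_apply_eq, hφS]
    simp
  have hφR' : ∀ x, WhitneyRel e K x (φ.symm x) := fun x => by
    simpa using (hφR (φ.symm x)).symm
  have hc : Continuous φ := by
    refine continuous_iff_continuousAt.2 fun x => ?_
    rcases hcases x with hx | ⟨s, hs⟩
    · exact continuousAt_of_whitneyRel he hφR hx
    · exact continuousAt_of_eq_on_isOpen (hclopen s).isOpen
        (continuous_subtype_val.comp (ψ s).continuous) (hφS s) hs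
  have hc' : Continuous φ.symm := by
    refine continuous_iff_continuousAt.2 fun x => ?_
    rcases hcases x with hx | ⟨s, hs⟩
    · exact continuousAt_of_whitneyRel he hφR' hx
    · exact continuousAt_of_eq_on_isOpen (hclopen s).isOpen
        (continuous_subtype_val.comp (ψ s).symm.continuous) (hφV s) hs
  refine ⟨⟨φ, hc, hc'⟩, hφR, fun x hx hxK => ?_⟩
  obtain ⟨s, hs⟩ := (hcases x).resolve_left hxK
  have h1 : φ x = ψ s ⟨x, hs⟩ := hφS s ⟨x, hs⟩
  change P x (φ x)
  rw [h1]
  exact hψ s ⟨x, hs⟩ hx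

/-- A finite stage in the construction of a homeomorphism mapping `D` onto `E`. -/
def IsStage (D E : Set X) (p : (X ≃ₜ X) × Set X) : Prop :=
  IsClosed p.2 ∧ ∀ x ∈ p.2, x ∈ D ↔ p.1 x ∈ E

theorem IsStage.exists_forth (he : Topology.IsEmbedding e)
    (hloc : ∀ D E A U : Set X, E.Countable → Dense E → IsAdapted D A → IsClopen U →
      U.Nonempty → ∃ ψ : U ≃ₜ U, ∀ u : U, (u : X) ∈ A → ((u : X) ∈ D ↔ (ψ u : X) ∈ E))
    {D E A : Set X} (hE : E.Countable) (hEd : Dense E) (hA : IsAdapted D A)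
    {p : (X ≃ₜ X) × Set X} (hp : IsStage D E p) :
    ∃ q, IsStage D E q ∧ p.2 ⊆ q.2 ∧ (∀ x, WhitneyRel e p.2 x (p.1.symm (q.1 x))) ∧ A ⊆ q.2 := by
  obtain ⟨g, hg, hgA⟩ := exists_homeomorph_whitneyRel he (A := A)
    (P := fun x y => x ∈ D ↔ y ∈ p.1 ⁻¹' E) hp.1 fun U hU hUne =>
      hloc D (p.1 ⁻¹' E) A U (hE.preimage p.1.injective)
        (hEd.preimage p.1.isOpenMap) hA hU hUne
  refine ⟨(g.trans p.1, p.2 ∪ A), ⟨hp.1.union hA.1, fun x hx => ?_⟩, subset_union_left,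
    fun x => by simpa using hg x, subset_union_right⟩
  by_cases hxK : x ∈ p.2
  · have : g x = x := (hg x).eq_of_mem he.injective hxK
    simpa [this] using hp.2 x hxK
  · exact hgA x (hx.resolve_left hxK) hxK

theorem IsStage.exists_back (he : Topology.IsEmbedding e)
    (hloc : ∀ D E A U : Set X, E.Countable → Dense E → IsAdapted D A → IsClopen U →
      U.Nonempty → ∃ ψ : U ≃ₜ U, ∀ u : U, (u : X) ∈ A → ((u : X) ∈ D ↔ (ψ u : X) ∈ E))
    {D E B : Set X} (hD : D.Countable) (hDd : Dense D) (hB : IsAdapted E B)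
    {p : (X ≃ₜ X) × Set X} (hp : IsStage D E p) :
    ∃ q, IsStage D E q ∧ p.2 ⊆ q.2 ∧ (∀ x, WhitneyRel e p.2 x (p.1.symm (q.1 x))) ∧
      B ⊆ q.1 '' q.2 := by
  have hA := hB.preimage p.1
  obtain ⟨g, hg, hgA⟩ := exists_homeomorph_whitneyRel he (A := p.1 ⁻¹' B)
    (P := fun x y => x ∈ p.1 ⁻¹' E ↔ y ∈ D) hp.1 fun U hU hUne =>
      hloc (p.1 ⁻¹' E) D _ U hD hDd hA hU hUne
  have hgK : ∀ x ∈ p.2, g x = x := fun x hx => (hg x).eq_of_mem he.injective hx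
  refine ⟨(g.symm.trans p.1, p.2 ∪ g '' (p.1 ⁻¹' B)),
    ⟨hp.1.union (g.isClosedMap _ hA.1), fun x hx => ?_⟩, subset_union_left,
    fun x => by simpa using (hg (g.symm x)).symm, fun y hy => ?_⟩
  · by_cases hxK : x ∈ p.2
    · have : g.symm x = x := by rw [Homeomorph.symm_apply_eq, hgK x hxK]
      simpa [this] using hp.2 x hxK
    · obtain ⟨a, ha, rfl⟩ := hx.resolve_left hxK
      have haK : a ∉ p.2 := fun h => hxK ((hgK a h).symm ▸ h)
      simpa using (hgA a ha haK).symm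
  · exact ⟨g (p.1.symm y), Or.inr ⟨_, by simpa using hy, rfl⟩, by simp⟩

/-- A λ-set all of whose nonempty clopen subsets are homeomorphic to it, and which embeds as
a closed nowhere dense set into the complement of any countable set, is CDH. -/
theorem isCDH_of_forall_clopen [SecondCountableTopology X] [T1Space X]
    (he : Topology.IsEmbedding e)
    (hX : ∀ U : Set X, IsClopen U → U.Nonempty → Nonempty (U ≃ₜ X))
    (hpt : ∀ x : X, interior {x} = ∅)
    (hpush : ∀ E : Set X, E.Countable →
      ∃ j : X → X, Topology.IsClosedEmbedding j ∧ interior (range j) = ∅ ∧ Disjoint (range j) E)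
    (hGδ : ∀ A : Set X, A.Countable → IsGδ A) : IsCDH X := by
  intro D E hD hDd hE hEd
  obtain ⟨A, hA, hAu⟩ := exists_seq_isAdapted hpt hD hDd (hGδ D hD)
  obtain ⟨B, hB, hBu⟩ := exists_seq_isAdapted hpt hE hEd (hGδ E hE)
  have hloc : ∀ D E A U : Set X, E.Countable → Dense E → IsAdapted D A → IsClopen U →
      U.Nonempty → ∃ ψ : U ≃ₜ U, ∀ u : U, (u : X) ∈ A → ((u : X) ∈ D ↔ (ψ u : X) ∈ E) :=
    fun D E A U h1 h2 h3 h4 h5 => exists_homeomorph_clopen he hX hpt hpush h1 h2 h3 h4 h5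
  have hstep : ∀ (n : ℕ) (p : {p // IsStage D E p}), ∃ q : {p // IsStage D E p},
      p.1.2 ⊆ q.1.2 ∧ (∀ x, WhitneyRel e p.1.2 x (p.1.1.symm (q.1.1 x))) ∧ A n ⊆ q.1.2 ∧
        B n ⊆ q.1.1 '' q.1.2 := by
    rintro n ⟨p, hp⟩
    obtain ⟨q, hq, hpq, hpqR, hqA⟩ := hp.exists_forth he hloc hE hEd (hA n)
    obtain ⟨r, hr, hqr, hqrR, hrB⟩ := hq.exists_back he hloc hD hDd (hB n)
    refine ⟨⟨r, hr⟩, hpq.trans hqr, fun x => ?_, hqA.trans hqr, hrB⟩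
    have h1 := (hqrR x).mono hpq
    have h2 := hpqR (q.1.symm (r.1 x))
    rw [Homeomorph.apply_symm_apply] at h2
    exact h1.trans h2
  choose next hsub hR hnA hnB using hstep
  let s : ℕ → {p // IsStage D E p} := fun n =>
    Nat.rec ⟨(Homeomorph.refl X, ∅), isClosed_empty, by simp⟩ next n
  have hmono : Monotone fun n => (s n).1.2 := monotone_nat_of_le_succ fun n => hsub n (s n)
  have hdom : ⋃ n, (s n).1.2 = univ := by
    refine eq_univ_of_univ_subset ?_
    rw [← hAu]
    exact iUnion_subset fun n => (hnA n (s n)).trans (subset_iUnion (fun n => (s n).1.2) (n + 1))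
  have hrange : ⋃ n, (s n).1.1 '' (s n).1.2 = univ := by
    refine eq_univ_of_univ_subset ?_
    rw [← hBu]
    exact iUnion_subset fun n =>
      (hnB n (s n)).trans (subset_iUnion (fun n => (s n).1.1 '' (s n).1.2) (n + 1))
  obtain ⟨f, hf⟩ := exists_homeomorph_eqOn_iUnion he (f := fun n => (s n).1.1) hmono
    (fun n => hR n (s n)) hdom hrange
  have hDE : ∀ x, x ∈ D ↔ f x ∈ E := by
    intro x
    obtain ⟨n, hn⟩ := mem_iUnion.1 (hdom ▸ mem_univ x)
    rw [hf n x hn]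
    exact (s n).2.2 x hn
  refine ⟨f, ?_⟩
  ext y
  constructor
  · rintro ⟨x, hx, rfl⟩
    exact (hDE x).1 hx
  · intro hy
    exact ⟨f.symm y, (hDE _).2 (by simpa using hy), by simp⟩

end BackAndForth

/-! ### Spaces all of whose clopen subsets are homeomorphic -/

section Clopen

variable {X Y : Type*} [TopologicalSpace X] [TopologicalSpace Y]

theorem nonempty_sum_homeomorph_of_isOpen {s t u : Set X} (hs : IsOpen s) (ht : IsOpen t)
    (hst : Disjoint s t) (hu : s ∪ t = u) : Nonempty (s ⊕ t ≃ₜ u) := by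
  have hsu : s ⊆ u := hu ▸ subset_union_left
  have htu : t ⊆ u := hu ▸ subset_union_right
  let f : s ⊕ t → u := Sum.elim (inclusion hsu) (inclusion htu)
  have hf : Function.Bijective f := by
    constructor
    · refine (inclusion_injective hsu).sumElim (inclusion_injective htu) fun a b h => ?_
      have : (a : X) = b := congrArg Subtype.val h
      exact disjoint_left.1 hst a.2 (this ▸ b.2)
    · rintro ⟨x, hx⟩
      rw [← hu] at hx
      rcases hx with hx | hx
      · exact ⟨Sum.inl ⟨x, hx⟩, rfl⟩
      · exact ⟨Sum.inr ⟨x, hx⟩, rfl⟩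
  exact ⟨(Equiv.ofBijective f hf).toHomeomorphOfContinuousOpen
    ((continuous_inclusion hsu).sumElim (continuous_inclusion htu))
    ((hs.isOpenMap_inclusion hsu).sumElim (ht.isOpenMap_inclusion htu))⟩

/-- The product of `ℕ` with a space absorbs each summand of that space. -/
theorem nonempty_nat_prod_sum_homeomorph {A B : Type*} [TopologicalSpace A] [TopologicalSpace B]
    (h : A ⊕ B ≃ₜ X) : Nonempty ((ℕ × X) ⊕ A ≃ₜ ℕ × X) := by
  have hnat : ℕ ⊕ Unit ≃ₜ ℕ := Equiv.natSumPUnitEquivNat.toHomeomorphOfDiscrete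
  have hA : (ℕ × A) ⊕ A ≃ₜ ℕ × A :=
    (((Homeomorph.refl _).sumCongr (Homeomorph.punitProd A).symm).trans
      Homeomorph.sumProdDistrib.symm).trans (hnat.prodCongr (Homeomorph.refl A))
  have hX : ℕ × X ≃ₜ (ℕ × A) ⊕ (ℕ × B) :=
    ((Homeomorph.refl ℕ).prodCongr h.symm).trans Homeomorph.prodSumDistrib
  refine ⟨(hX.sumCongr (Homeomorph.refl A)).trans (Homeomorph.trans ?_ hX.symm)⟩
  exact (((Homeomorph.sumComm _ _).sumCongr (Homeomorph.refl A)).trans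
    (Homeomorph.sumAssoc _ _ _)).trans
      (((Homeomorph.refl _).sumCongr hA).trans (Homeomorph.sumComm _ _))

theorem nonempty_nat_prod_sum_homeomorph_of_isClopen {A : Set X} (hA : IsClopen A) :
    Nonempty ((ℕ × X) ⊕ A ≃ₜ ℕ × X) := by
  obtain ⟨h⟩ := nonempty_sum_homeomorph_of_isOpen hA.isOpen hA.compl.isOpen disjoint_compl_right
    (union_compl_self A)
  exact nonempty_nat_prod_sum_homeomorph (h.trans (Homeomorph.Set.univ X))

theorem isClopen_iUnion_of_subset {P C : ℕ → Set X} (hP : ∀ n, IsOpen (P n))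
    (hd : Pairwise fun m n => Disjoint (P m) (P n)) (hu : ⋃ n, P n = univ)
    (hC : ∀ n, IsClopen (C n)) (hCP : ∀ n, C n ⊆ P n) : IsClopen (⋃ n, C n) := by
  refine ⟨?_, isOpen_iUnion fun n => (hC n).isOpen⟩
  have : (⋃ n, C n)ᶜ = ⋃ n, P n \ C n := by
    ext x
    obtain ⟨n, hn⟩ := mem_iUnion.1 (hu ▸ mem_univ x)
    simp only [mem_compl_iff, mem_iUnion, mem_sdiff, not_exists]
    refine ⟨fun h => ⟨n, hn, h n⟩, ?_⟩
    rintro ⟨m, hm, hm'⟩ k hk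
    obtain rfl : k = m := by
      by_contra hkm
      exact disjoint_left.1 (hd hkm) (hCP k hk) hm
    exact hm' hk
  rw [← isOpen_compl_iff, this]
  exact isOpen_iUnion fun n => (hP n).sdiff (hC n).isClosed

/-- If `X` has an infinite clopen partition and every nonempty open set contains a clopen copy
of `X`, then all nonempty clopen subsets of `X` are homeomorphic to `X`. -/
theorem nonempty_homeomorph_of_isClopen {P : ℕ → Set X} (hP : ∀ n, IsOpen (P n))
    (hne : ∀ n, (P n).Nonempty) (hd : Pairwise fun m n => Disjoint (P m) (P n))
    (hu : ⋃ n, P n = univ)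
    (hbase : ∀ O : Set X, IsOpen O → O.Nonempty → ∃ C ⊆ O, IsClopen C ∧ Nonempty (C ≃ₜ X))
    (U : Set X) (hU : IsClopen U) (hUne : U.Nonempty) : Nonempty (U ≃ₜ X) := by
  choose C hCP hC θ using fun n => hbase (P n) (hP n) (hne n)
  have θ : ∀ n, C n ≃ₜ X := fun n => (θ n).some
  let j : ℕ × X → X := fun p => (θ p.1).symm p.2
  have hjmem : ∀ p, j p ∈ C p.1 := fun p => ((θ p.1).symm p.2).2
  have hj : Topology.IsOpenEmbedding j := by
    refine Topology.IsOpenEmbedding.of_continuous_injective_isOpenMap ?_ ?_ ?_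
    · exact continuous_prod_of_discrete_left.2 fun n =>
        continuous_subtype_val.comp (θ n).symm.continuous
    · rintro ⟨m, x⟩ ⟨n, y⟩ h
      obtain rfl : m = n := by
        by_contra hmn
        refine disjoint_left.1 (hd hmn) (hCP m (hjmem (m, x))) ?_
        rw [h]
        exact hCP n (hjmem (n, y))
      simpa [j, Subtype.val_inj] using h
    · exact isOpenMap_prod_of_discrete_left.2 fun n =>
        (hC n).isOpen.isOpenMap_subtype_val.comp (θ n).symm.isOpenMap
  have hjr : range j = ⋃ n, C n := by
    ext x
    constructor
    · rintro ⟨p, rfl⟩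
      exact mem_iUnion.2 ⟨p.1, hjmem p⟩
    · intro hx
      obtain ⟨n, hn⟩ := mem_iUnion.1 hx
      exact ⟨(n, θ n ⟨x, hn⟩), by simp [j]⟩
  have hR : IsClopen (range j) := hjr ▸ isClopen_iUnion_of_subset hP hd hu hC hCP
  have hsplit : ∀ {s t u : Set X}, IsClopen s → IsClopen t → Disjoint s t → s ∪ t = u →
      (s ≃ₜ ℕ × X) → Nonempty (u ≃ₜ ℕ × X) := by
    intro s t u hs ht hst hu h
    obtain ⟨a⟩ := nonempty_sum_homeomorph_of_isOpen hs.isOpen ht.isOpen hst hu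
    obtain ⟨b⟩ := nonempty_nat_prod_sum_homeomorph_of_isClopen ht
    exact ⟨a.symm.trans ((h.sumCongr (Homeomorph.refl t)).trans b)⟩
  obtain ⟨a⟩ := hsplit hR hR.compl disjoint_compl_right (union_compl_self _)
    hj.isEmbedding.toHomeomorph.symm
  have a : X ≃ₜ ℕ × X := (Homeomorph.Set.univ X).symm.trans a
  obtain ⟨V, hVU, hV, ⟨φ⟩⟩ := hbase U hU.isOpen hUne
  obtain ⟨b⟩ := hsplit hV (hU.diff hV) disjoint_sdiff_right (union_sdiff_cancel hVU) (φ.trans a)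
  exact ⟨b.trans a.symm⟩

end Clopen

/-! ### Finitely supported sequences -/

/-- The space of sequences in `Z` which are eventually equal to `z₀`. -/
def FinSupp (Z : Type*) (z₀ : Z) : Type _ :=
  {x : ℕ → Z // ∃ n, ∀ k ≥ n, x k = z₀}

namespace FinSupp

variable {Z : Type*} {z₀ : Z}

instance : CoeFun (FinSupp Z z₀) fun _ => ℕ → Z := ⟨Subtype.val⟩

@[ext]
theorem ext {x y : FinSupp Z z₀} (h : ∀ n, x n = y n) : x = y := Subtype.ext (funext h)

/-- Prepend a term to a finitely supported sequence. -/
def cons (z : Z) (x : FinSupp Z z₀) : FinSupp Z z₀ :=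
  ⟨fun n => Nat.casesOn n z x, by
    obtain ⟨n, hn⟩ := x.2
    refine ⟨n + 1, fun k hk => ?_⟩
    obtain ⟨k, rfl⟩ : ∃ l, k = l + 1 := ⟨k - 1, by omega⟩
    exact hn k (by omega)⟩

/-- Remove the first term of a finitely supported sequence. -/
def tail (x : FinSupp Z z₀) : FinSupp Z z₀ :=
  ⟨fun n => x (n + 1), by
    obtain ⟨n, hn⟩ := x.2
    exact ⟨n, fun k hk => hn (k + 1) (by omega)⟩⟩

/-- The constant sequence. -/
def zero (z₀ : Z) : FinSupp Z z₀ := ⟨fun _ => z₀, 0, fun _ _ => rfl⟩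

theorem cons_head_tail (x : FinSupp Z z₀) : cons (x 0) (tail x) = x := by
  ext n
  cases n <;> rfl

theorem exists_apply_eq (x : FinSupp Z z₀) : ∃ n, x n = z₀ := by
  obtain ⟨n, hn⟩ := x.2
  exact ⟨n, hn n le_rfl⟩

theorem finite_range (x : FinSupp Z z₀) : (range x).Finite := by
  obtain ⟨n, hn⟩ := x.2
  refine (((finite_lt_nat n).image x).union (finite_singleton z₀)).subset ?_
  rintro _ ⟨k, rfl⟩
  rcases lt_or_ge k n with hk | hk
  · exact Or.inl ⟨k, hk, rfl⟩
  · exact Or.inr (hn k hk)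

theorem range_cons (z : Z) : range (cons z : FinSupp Z z₀ → FinSupp Z z₀) = {x | x 0 = z} := by
  ext x
  constructor
  · rintro ⟨y, rfl⟩; rfl
  · intro (hx : x 0 = z)
    exact ⟨tail x, hx ▸ cons_head_tail x⟩

/-- The finitely supported sequence given by a list. -/
def ofList (l : List Z) : FinSupp Z z₀ :=
  ⟨fun n => l.getD n z₀, l.length, fun _ hk => List.getD_eq_default _ _ hk⟩

theorem surjective_ofList : Function.Surjective (ofList : List Z → FinSupp Z z₀) := by
  intro x
  obtain ⟨n, hn⟩ := x.2
  refine ⟨List.ofFn fun k : Fin n => x k, ?_⟩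
  ext k
  rcases lt_or_ge k n with hk | hk
  · simp [ofList, hk]
  · simp only [ofList]
    rw [List.getD_eq_default _ _ (by simpa using hk), hn k hk]

theorem mk_eq {Z : Type*} [Infinite Z] (z₀ : Z) : Cardinal.mk (FinSupp Z z₀) = Cardinal.mk Z := by
  apply le_antisymm
  · refine (Cardinal.mk_le_of_surjective surjective_ofList).trans ?_
    rw [Cardinal.mk_list_eq_mk]
  · refine Cardinal.mk_le_of_injective (f := fun z => cons z (zero z₀)) fun a b h => ?_
    exact congrArg (fun x : FinSupp Z z₀ => x 0) h

theorem countable_forall_mem {S : Set Z} (hS : S.Countable) :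
    {x : FinSupp Z z₀ | ∀ n, x n ∈ S}.Countable := by
  have : {x : FinSupp Z z₀ | ∀ n, x n ∈ S} ⊆
      range fun l : List S => ofList (z₀ := z₀) (l.map Subtype.val) := by
    intro x hx
    obtain ⟨n, hn⟩ := x.2
    refine ⟨List.ofFn fun k : Fin n => ⟨x k, hx k⟩, ?_⟩
    ext k
    rcases lt_or_ge k n with hk | hk
    · simp [ofList, hk]
    · simp only [ofList]
      rw [List.getD_eq_default _ _ (by simpa using hk), hn k hk]
  have := hS.to_subtype
  exact (countable_range _).mono ‹_›

variable [TopologicalSpace Z]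

instance : TopologicalSpace (FinSupp Z z₀) := instTopologicalSpaceSubtype

theorem continuous_apply (n : ℕ) : Continuous fun x : FinSupp Z z₀ => x n :=
  (_root_.continuous_apply n).comp continuous_subtype_val

theorem continuous_iff {Y : Type*} [TopologicalSpace Y] {f : Y → FinSupp Z z₀} :
    Continuous f ↔ ∀ n, Continuous fun y => f y n :=
  continuous_induced_rng.trans continuous_pi_iff

theorem continuous_cons (z : Z) : Continuous (cons z : FinSupp Z z₀ → FinSupp Z z₀) := by
  refine continuous_iff.2 fun n => ?_
  cases n with
  | zero => exact continuous_const
  | succ n => exact continuous_apply n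

theorem continuous_tail : Continuous (tail : FinSupp Z z₀ → FinSupp Z z₀) :=
  continuous_iff.2 fun n => continuous_apply (n + 1)

theorem isEmbedding_cons (z : Z) :
    Topology.IsEmbedding (cons z : FinSupp Z z₀ → FinSupp Z z₀) :=
  .of_leftInverse (f := tail) (fun _ => rfl) continuous_tail (continuous_cons z)

/-- A binary code of a finitely supported sequence. -/
def code (c : Z → ℕ → Bool) (x : FinSupp Z z₀) (n : ℕ) : Bool :=
  c (x n.unpair.1) n.unpair.2

theorem isEmbedding_code {c : Z → ℕ → Bool} (hc : Topology.IsEmbedding c) :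
    Topology.IsEmbedding (code c : FinSupp Z z₀ → ℕ → Bool) := by
  have h1 : Topology.IsEmbedding (fun (x : FinSupp Z z₀) (n : ℕ) => c (x n)) :=
    (Topology.IsEmbedding.piMap fun _ : ℕ => hc).comp Topology.IsEmbedding.subtypeVal
  have h2 : Topology.IsEmbedding fun (f : ℕ → ℕ → Bool) (n : ℕ) => f n.unpair.1 n.unpair.2 := by
    refine .of_leftInverse (f := fun g m n => g (Nat.pair m n)) (fun f => ?_) ?_ ?_
    · ext m n; simp
    · fun_prop
    · fun_prop
  exact h2.comp h1

/-- The points which agree with `w` in the first `n` places. -/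
def cyl (w : FinSupp Z z₀) (n : ℕ) : Set (FinSupp Z z₀) := {x | ∀ k < n, x k = w k}

theorem nonempty_cyl_homeomorph (w : FinSupp Z z₀) (n : ℕ) :
    Nonempty (cyl w n ≃ₜ FinSupp Z z₀) := by
  let f : FinSupp Z z₀ → FinSupp Z z₀ := fun x => ⟨fun k => if k < n then w k else x (k - n), by
    obtain ⟨m, hm⟩ := x.2
    refine ⟨n + m, fun k hk => (if_neg (by omega)).trans (hm _ (by omega))⟩⟩
  let g : FinSupp Z z₀ → FinSupp Z z₀ := fun x => ⟨fun k => x (k + n), by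
    obtain ⟨m, hm⟩ := x.2
    exact ⟨m, fun k hk => hm _ (by omega)⟩⟩
  refine ⟨⟨⟨fun x => g x, fun x => ⟨f x, fun k hk => if_pos hk⟩, ?_, ?_⟩, ?_, ?_⟩⟩
  · rintro ⟨x, hx⟩
    refine Subtype.ext (ext fun k => ?_)
    change (if k < n then w k else x (k - n + n)) = x k
    split_ifs with hk
    · exact (hx k hk).symm
    · rw [Nat.sub_add_cancel (not_lt.1 hk)]
  · intro x
    refine ext fun k => ?_
    change (if k + n < n then w (k + n) else x (k + n - n)) = x k
    rw [if_neg (by omega), Nat.add_sub_cancel]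
  · exact continuous_iff.2 fun k => (continuous_apply (k + n)).comp continuous_subtype_val
  · refine Continuous.subtype_mk (continuous_iff.2 fun k => ?_) _
    change Continuous fun x : FinSupp Z z₀ => if k < n then w k else x (k - n)
    split_ifs
    · exact continuous_const
    · exact continuous_apply _

theorem isClopen_cyl [T1Space Z] {w : FinSupp Z z₀} {n : ℕ} (hw : ∀ k < n, IsOpen {w k}) :
    IsClopen (cyl w n) := by
  have : cyl w n = ⋂ k ∈ Finset.range n, (fun x : FinSupp Z z₀ => x k) ⁻¹' {w k} := by
    ext x; simp [cyl]
  rw [this]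
  refine isClopen_biInter_finset fun k hk => ?_
  exact IsClopen.preimage ⟨isClosed_singleton, hw k (by simpa using hk)⟩ (continuous_apply k)

theorem exists_cyl_subset (hiso : ∀ O : Set Z, IsOpen O → O.Nonempty → ∃ z ∈ O, IsOpen {z})
    {O : Set (FinSupp Z z₀)} (hO : IsOpen O) (hne : O.Nonempty) :
    ∃ w n, (∀ k < n, IsOpen {w k}) ∧ cyl w n ⊆ O := by
  obtain ⟨x, hx⟩ := hne
  obtain ⟨V, hV, rfl⟩ := isOpen_induced_iff.1 hO
  obtain ⟨I, u, hu, huV⟩ := isOpen_pi_iff.1 hV x hx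
  obtain ⟨N, hN⟩ : ∃ N, ∀ k ∈ I, k < N := ⟨I.sup id + 1, fun k hk =>
    Nat.lt_succ_of_le (Finset.le_sup (f := id) hk)⟩
  have : ∀ k, ∃ z, IsOpen {z} ∧ (k ∈ I → z ∈ u k) := by
    intro k
    by_cases hk : k ∈ I
    · obtain ⟨z, hz, hz'⟩ := hiso (u k) (hu k hk).1 ⟨x k, (hu k hk).2⟩
      exact ⟨z, hz', fun _ => hz⟩
    · obtain ⟨z, -, hz⟩ := hiso univ isOpen_univ ⟨z₀, mem_univ _⟩
      exact ⟨z, hz, fun h => absurd h hk⟩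
  choose z hz hzu using this
  refine ⟨⟨fun k => if k < N then z k else z₀, N, fun k hk => if_neg (not_lt.2 hk)⟩, N,
    fun k hk => ?_, fun y hy => huV fun k hk => ?_⟩
  · change IsOpen {if k < N then z k else z₀}
    rw [if_pos hk]
    exact hz k
  · have : y k = if k < N then z k else z₀ := hy k (hN k hk)
    rw [if_pos (hN k hk)] at this
    change y k ∈ u k
    rw [this]
    exact hzu k hk

theorem nonempty_homeomorph_of_isClopen [T1Space Z] [Nontrivial Z] (h₀ : IsOpen {z₀})
    (hiso : ∀ O : Set Z, IsOpen O → O.Nonempty → ∃ z ∈ O, IsOpen {z})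
    (U : Set (FinSupp Z z₀)) (hU : IsClopen U) (hne : U.Nonempty) :
    Nonempty (U ≃ₜ FinSupp Z z₀) := by
  have hcl : IsClopen {z₀} := ⟨isClosed_singleton, h₀⟩
  refine _root_.nonempty_homeomorph_of_isClopen
    (P := fun n => {x | x n = z₀ ∧ ∀ k < n, x k ≠ z₀}) ?_ ?_ ?_ ?_ ?_ U hU hne
  · intro n
    have : {x : FinSupp Z z₀ | x n = z₀ ∧ ∀ k < n, x k ≠ z₀} = (fun x => x n) ⁻¹' {z₀} ∩
        ⋂ k ∈ Finset.range n, (fun x : FinSupp Z z₀ => x k) ⁻¹' {z₀}ᶜ := by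
      ext x; simp
    rw [this]
    exact ((hcl.preimage (continuous_apply n)).inter (isClopen_biInter_finset fun k _ =>
      hcl.compl.preimage (continuous_apply k))).isOpen
  · intro n
    obtain ⟨z, hz⟩ := exists_ne z₀
    refine ⟨⟨fun k => if k < n then z else z₀, n, fun k hk => if_neg (not_lt.2 hk)⟩,
      if_neg (lt_irrefl n), fun k hk => ?_⟩
    change (if k < n then z else z₀) ≠ z₀
    rwa [if_pos hk]
  · intro m n hmn
    refine disjoint_left.2 fun x hx hx' => ?_
    rcases lt_or_gt_of_ne hmn with h | h
    · exact hx'.2 m h hx.1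
    · exact hx.2 n h hx'.1
  · classical
    refine eq_univ_of_forall fun x => mem_iUnion.2 ⟨Nat.find x.exists_apply_eq, ?_, fun k hk => ?_⟩
    · exact Nat.find_spec x.exists_apply_eq
    · exact Nat.find_min x.exists_apply_eq hk
  · intro O hO hne
    obtain ⟨w, n, hw, hwO⟩ := exists_cyl_subset hiso hO hne
    exact ⟨cyl w n, hwO, isClopen_cyl hw, nonempty_cyl_homeomorph w n⟩

theorem isGδ_of_countable [T1Space (FinSupp Z z₀)] (hGδ : ∀ S : Set Z, S.Countable → IsGδ S)
    {A : Set (FinSupp Z z₀)} (hA : A.Countable) : IsGδ A := by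
  let S : Set Z := ⋃ x ∈ A, range x
  have hS : S.Countable := hA.biUnion fun x _ => x.finite_range.countable
  have hB : IsGδ {x : FinSupp Z z₀ | ∀ n, x n ∈ S} := by
    rw [ofPred_forall]
    exact .iInter fun n => (hGδ S hS).preimage (continuous_apply n)
  have hAB : A = {x : FinSupp Z z₀ | ∀ n, x n ∈ S} ∩ ({x | ∀ n, x n ∈ S} \ A)ᶜ := by
    ext x
    constructor
    · exact fun hx => ⟨fun n => mem_biUnion hx (mem_range_self n), fun h => h.2 hx⟩
    · exact fun hx => by_contra fun h => hx.2 ⟨hx.1, h⟩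
  rw [hAB]
  exact hB.inter ((countable_forall_mem hS).mono sdiff_subset).isGδ_compl

theorem interior_singleton [Nontrivial Z]
    (hiso : ∀ O : Set Z, IsOpen O → O.Nonempty → ∃ z ∈ O, IsOpen {z}) (x : FinSupp Z z₀) :
    interior {x} = ∅ := by
  by_contra h
  obtain ⟨w, n, hw, hwx⟩ := exists_cyl_subset hiso isOpen_interior (nonempty_iff_ne_empty.2 h)
  obtain ⟨φ⟩ := nonempty_cyl_homeomorph w n
  obtain ⟨z, hz⟩ := exists_ne z₀
  have h1 := interior_subset (hwx (φ.symm (cons z (zero z₀))).2)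
  have h2 := interior_subset (hwx (φ.symm (zero z₀)).2)
  have h3 := φ.symm.injective (Subtype.ext (h1.trans h2.symm))
  exact hz (congrArg (fun x : FinSupp Z z₀ => x 0) h3)

theorem exists_isClosedEmbedding [T1Space Z] [SecondCountableTopology Z] [Uncountable Z]
    (hiso : ∀ O : Set Z, IsOpen O → O.Nonempty → ∃ z ∈ O, IsOpen {z})
    {E : Set (FinSupp Z z₀)} (hE : E.Countable) :
    ∃ j : FinSupp Z z₀ → FinSupp Z z₀, Topology.IsClosedEmbedding j ∧
      interior (range j) = ∅ ∧ Disjoint (range j) E := by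
  have hI : {z : Z | IsOpen {z}}.Countable := by
    let b := countableBasis Z
    refine ((countable_countableBasis Z).preimage (f := fun z : Z => ({z} : Set Z))
      singleton_injective).mono fun z (hz : IsOpen {z}) => ?_
    obtain ⟨v, hv, hzv, hvz⟩ := (isBasis_countableBasis Z).exists_subset_of_mem_open
      (mem_singleton z) hz
    have : v = {z} :=
      (subset_singleton_iff_eq.1 hvz).resolve_left (nonempty_iff_ne_empty.1 ⟨z, hzv⟩)
    exact mem_preimage.2 (this ▸ hv)
  obtain ⟨z, hz⟩ : ∃ z, z ∉ {z : Z | IsOpen {z}} ∪ (fun x : FinSupp Z z₀ => x 0) '' E := by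
    by_contra! h
    exact not_countable_univ ((hI.union (hE.image _)).mono fun z _ => h z)
  refine ⟨cons z, ⟨isEmbedding_cons z, ?_⟩, ?_, ?_⟩
  · rw [range_cons]
    exact isClosed_singleton.preimage (continuous_apply 0)
  · by_contra h
    obtain ⟨w, n, hw, hwx⟩ := exists_cyl_subset hiso isOpen_interior (nonempty_iff_ne_empty.2 h)
    rw [range_cons] at hwx
    obtain ⟨y, hy, hyz⟩ : ∃ y ∈ cyl w n, IsOpen {y 0} := by
      rcases n.eq_zero_or_pos with rfl | hn
      · obtain ⟨a, -, ha⟩ := hiso univ isOpen_univ ⟨z, mem_univ _⟩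
        exact ⟨cons a (zero z₀), fun k hk => absurd hk (Nat.not_lt_zero k), ha⟩
      · exact ⟨w, fun k _ => rfl, hw 0 hn⟩
    have : y ∈ {x : FinSupp Z z₀ | x 0 = z} := interior_subset (hwx hy)
    rw [mem_ofPred_eq] at this
    exact hz (Or.inl (this ▸ hyz))
  · rw [range_cons]
    exact disjoint_left.2 fun x (hx : x 0 = z) hxE => hz (Or.inr ⟨x, hxE, hx⟩)

/-- If `Z` is an uncountable λ-set with a dense set of isolated points, including `z₀`, then
the space of sequences in `Z` which are eventually equal to `z₀` is CDH. -/
theorem isCDH {c : Z → ℕ → Bool} (hc : Topology.IsEmbedding c) [Uncountable Z]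
    (h₀ : IsOpen {z₀}) (hiso : ∀ O : Set Z, IsOpen O → O.Nonempty → ∃ z ∈ O, IsOpen {z})
    (hGδ : ∀ S : Set Z, S.Countable → IsGδ S) : IsCDH (FinSupp Z z₀) := by
  have := hc.t2Space
  have := hc.secondCountableTopology
  have hcode := isEmbedding_code (z₀ := z₀) hc
  have := hcode.t2Space
  have := hcode.secondCountableTopology
  exact isCDH_of_forall_clopen hcode (nonempty_homeomorph_of_isClopen h₀ hiso)
    (interior_singleton hiso) (fun E hE => exists_isClosedEmbedding hiso hE)
    fun A hA => isGδ_of_countable hGδ hA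

end FinSupp

/-! ### Changing the topology -/

section Code

open Classical in
/-- The binary code of a point given by membership in a sequence of sets. -/
noncomputable def membershipCode {X : Type*} (b : ℕ → Set X) (x : X) (n : ℕ) : Bool :=
  decide (x ∈ b n)

variable {X : Type*}

theorem membershipCode_eq_iff {b : ℕ → Set X} {x y : X} {n : ℕ} :
    membershipCode b x n = membershipCode b y n ↔ (x ∈ b n ↔ y ∈ b n) := by
  simp [membershipCode]

theorem IsGδ.of_le {t t' : TopologicalSpace X} (h : t' ≤ t) {s : Set X} (hs : @IsGδ X t s) :
    @IsGδ X t' s :=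
  @IsGδ.preimage X X t' t id s (continuous_id_of_le h) hs

variable [t : TopologicalSpace X] {b : ℕ → Set X}

theorem injective_membershipCode [T0Space X] (hb : IsTopologicalBasis (range b)) :
    Function.Injective (membershipCode b) := by
  intro x y h
  refine hb.eq_iff.2 ?_
  rintro _ ⟨n, rfl⟩
  exact membershipCode_eq_iff.1 (congrFun h n)

theorem continuous_membershipCode (hb : ∀ n, IsClopen (b n)) : Continuous (membershipCode b) := by
  refine continuous_pi fun n => continuous_bool_rng true |>.2 ?_
  convert hb n using 1
  ext x; simp [membershipCode]

theorem induced_membershipCode_le (hb : IsTopologicalBasis (range b)) :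
    TopologicalSpace.induced (membershipCode b) inferInstance ≤ t := by
  rw [hb.eq_generateFrom]
  refine le_generateFrom ?_
  rintro _ ⟨n, rfl⟩
  refine isOpen_induced_iff.2 ⟨(fun f => f n) ⁻¹' {true}, ?_, ?_⟩
  · exact (isOpen_discrete _).preimage (continuous_apply n)
  · ext x; simp [membershipCode]

theorem zeroDimensional_of_isEmbedding {e : X → ℕ → Bool} (he : Topology.IsEmbedding e) :
    ZeroDimensional X := by
  refine ⟨{s | ∃ n x, s = cylinderSet e n x}, isTopologicalBasis_of_isOpen_of_nhds ?_ ?_, ?_⟩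
  · rintro _ ⟨n, x, rfl⟩
    exact (isClopen_cylinderSet he.continuous n x).isOpen
  · intro x s hx hs
    obtain ⟨n, hn⟩ := exists_cylinderSet_subset he.isInducing (hs.mem_nhds hx)
    exact ⟨_, ⟨n, x, rfl⟩, mem_cylinderSet_self e n x, hn⟩
  · rintro _ ⟨n, x, rfl⟩
    exact isClopen_cylinderSet he.continuous n x

theorem ZeroDimensional.exists_isEmbedding [SecondCountableTopology X] [T0Space X]
    (h : ZeroDimensional X) : ∃ e : X → ℕ → Bool, Topology.IsEmbedding e := by
  obtain ⟨B, hB, hBc⟩ := h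
  obtain ⟨C, hCB, hCc, hC⟩ := hB.exists_countable
  have hC' : IsTopologicalBasis (insert ∅ C) := hC.insert_empty
  obtain ⟨b, hb⟩ := (hCc.insert ∅).exists_eq_range (insert_nonempty _ _)
  rw [hb] at hC'
  have hcl : ∀ n, IsClopen (b n) := by
    intro n
    have : b n ∈ insert ∅ C := hb ▸ mem_range_self n
    rcases this with h | h
    · exact h ▸ isClopen_empty
    · exact hBc _ (hCB h)
  refine ⟨membershipCode b, ⟨⟨le_antisymm ?_ (induced_membershipCode_le hC')⟩,
    injective_membershipCode hC'⟩⟩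
  exact continuous_iff_le_induced.1 (continuous_membershipCode hcl)

end Code

/-! ### The two implications -/

section Main

open scoped Topology

variable {X : Type*}

theorem isMeagre_univ_of_interior_singleton [TopologicalSpace X] [SeparableSpace X] [T1Space X]
    (hpt : ∀ x : X, interior {x} = ∅) (hGδ : ∀ A : Set X, A.Countable → IsGδ A) :
    IsMeagre (univ : Set X) := by
  obtain ⟨D, hD, hDd⟩ := exists_countable_dense X
  obtain ⟨A, hA, hAu⟩ := exists_seq_isAdapted hpt hD hDd (hGδ D hD)
  rw [← hAu]
  exact isMeagre_iUnion fun n => ((hA n).1.isNowhereDense_iff.2 (hA n).2.1).isMeagre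

theorem exists_countable_dense_isGδ [TopologicalSpace X] [SecondCountableTopology X] [T1Space X]
    (h : IsMeagre (univ : Set X)) : ∃ D : Set X, D.Countable ∧ Dense D ∧ IsGδ D := by
  cases isEmpty_or_nonempty X
  · exact ⟨∅, countable_empty, fun x => isEmptyElim x, .empty⟩
  obtain ⟨S, hSo, hSd, hSc, hS⟩ := mem_residual_iff.1 h
  obtain ⟨O, hO⟩ := (hSc.insert univ).exists_eq_range (insert_nonempty _ _)
  have hOS : ∀ n, O n ∈ insert univ S := fun n => hO ▸ mem_range_self n
  have hOo : ∀ n, IsOpen (O n) := fun n => (hOS n).elim (fun h => h ▸ isOpen_univ) (hSo _)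
  have hOd : ∀ n, Dense (O n) := fun n => (hOS n).elim (fun h => h ▸ dense_univ) (hSd _)
  have hOe : ∀ x, ∃ n, x ∉ O n := by
    intro x
    by_contra! hx
    refine hS (fun s hs => ?_ : x ∈ ⋂₀ S) (mem_univ x)
    obtain ⟨n, rfl⟩ : s ∈ range O := hO ▸ mem_insert_of_mem _ hs
    exact hx n
  have hW : ∀ n, IsOpen (⋂ k ∈ Finset.range n, O k) ∧ Dense (⋂ k ∈ Finset.range n, O k) := by
    intro n
    induction n with
    | zero => simp
    | succ n ih =>
      rw [Finset.range_add_one, Finset.set_biInter_insert]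
      exact ⟨(hOo n).inter ih.1, (hOd n).inter_of_isOpen_left ih.2 (hOo n)⟩
  obtain ⟨b, hb⟩ := exists_seq_basis X
  have : ∀ n, ∃ x, ((b n).Nonempty → x ∈ b n) ∧ ∀ k < n + 1, x ∈ O k := by
    intro n
    have h1 := (hW (n + 1)).2
    by_cases hn : (b n).Nonempty
    · obtain ⟨x, hx, hx'⟩ := h1.inter_open_nonempty _ (hb.isOpen ⟨n, rfl⟩) hn
      exact ⟨x, fun _ => hx, by simpa using hx'⟩
    · obtain ⟨x, hx⟩ := h1.nonempty
      exact ⟨x, fun h => absurd h hn, by simpa using hx⟩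
  choose d hdb hdO using this
  refine ⟨range d, countable_range d, hb.dense_iff.2 ?_, ?_⟩
  · rintro _ ⟨n, rfl⟩ hn
    exact ⟨d n, hdb n hn, mem_range_self n⟩
  · have : range d = ⋂ m, (O m ∪ d '' {n | n < m}) := by
      ext x
      constructor
      · rintro ⟨n, rfl⟩
        refine mem_iInter.2 fun m => ?_
        rcases lt_or_ge n m with hm | hm
        · exact Or.inr ⟨n, hm, rfl⟩
        · exact Or.inl (hdO n m (Nat.lt_succ_of_le hm))
      · intro hx
        obtain ⟨m, hm⟩ := hOe x
        obtain ⟨n, -, rfl⟩ := (mem_iInter.1 hx m).resolve_left hm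
        exact mem_range_self n
    rw [this]
    exact .iInter fun m => (hOo m).isGδ.union ((finite_lt_nat m).image d).isGδ

theorem IsCDH.isGδ_of_countable [TopologicalSpace X] [SecondCountableTopology X] [T1Space X]
    (hX : IsCDH X) (h : IsMeagre (univ : Set X)) {A : Set X} (hA : A.Countable) : IsGδ A := by
  obtain ⟨D, hD, hDd, hDG⟩ := exists_countable_dense_isGδ h
  obtain ⟨f, hf⟩ := hX D (D ∪ A) hD hDd (hD.union hA) (hDd.mono subset_union_left)
  have hU : IsGδ (D ∪ A) := by
    rw [← hf, f.image_eq_preimage_symm]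
    exact hDG.preimage f.symm.continuous
  have : A = (D ∪ A) ∩ (D \ A)ᶜ := by
    ext x
    by_cases hx : x ∈ A <;> simp [hx]
  rw [this]
  exact hU.inter (hD.mono sdiff_subset).isGδ_compl

theorem exists_isLambdaSpace [t : TopologicalSpace X] [SecondCountableTopology X] [T1Space X]
    (hGδ : ∀ A : Set X, A.Countable → IsGδ A) : ∃ t' : TopologicalSpace X, @IsLambdaSpace X t' := by
  obtain ⟨b, hb⟩ := exists_seq_basis X
  have hle := induced_membershipCode_le hb
  have hG : ∀ A : Set X, A.Countable → @IsGδ X (.induced (membershipCode b) inferInstance) A :=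
    fun A hA => .of_le hle (hGδ A hA)
  have hinj := injective_membershipCode hb
  let t' : TopologicalSpace X := .induced (membershipCode b) inferInstance
  have he : @Topology.IsEmbedding X _ t' _ (membershipCode b) := hinj.isEmbedding_induced
  exact ⟨t', @zeroDimensional_of_isEmbedding X t' _ he,
    @SecondCountableTopology.to_separableSpace X t' he.secondCountableTopology,
    he.metrizableSpace, hG⟩

theorem exists_cylinderSet_subset_of_isOpen_induced {e : X → ℕ → Bool} {O : Set X} {x : X}
    (hO : IsOpen[.induced e inferInstance] O) (hx : x ∈ O) : ∃ n, cylinderSet e n x ⊆ O := by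
  let : TopologicalSpace X := .induced e inferInstance
  exact exists_cylinderSet_subset ⟨rfl⟩ (IsOpen.mem_nhds hO hx)

/-- The topology of a separable space which embeds in the Cantor set can be refined so that the
isolated points become dense. -/
theorem exists_refinement [t : TopologicalSpace X] [Nonempty X] [SeparableSpace X]
    {c : X → ℕ → Bool} (hc : Topology.IsEmbedding c) :
    ∃ t' ≤ t, ∃ e : X → ℕ → Bool, @Topology.IsEmbedding X _ t' _ e ∧ ∃ z₀, IsOpen[t'] {z₀} ∧
      ∀ O, IsOpen[t'] O → O.Nonempty → ∃ z ∈ O, IsOpen[t'] {z} := by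
  obtain ⟨q, hq⟩ := exists_dense_seq X
  let e : X → ℕ → Bool := fun x k =>
    Sum.elim (c x) (membershipCode (fun n => {q n}) x) (Equiv.natSumNatEquivNat.symm k)
  have hel : ∀ x n, e x (Equiv.natSumNatEquivNat (Sum.inl n)) = c x n := fun x n => by simp [e]
  have her : ∀ x n, e x (Equiv.natSumNatEquivNat (Sum.inr n)) =
    membershipCode (fun n => {q n}) x n := fun x n => by simp [e]
  have hinj : Function.Injective e := fun x y h => hc.injective <| funext fun n => by
    rw [← hel, h, hel]
  have hle : TopologicalSpace.induced e inferInstance ≤ t := by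
    have hg : Continuous fun (f : ℕ → Bool) n => f (Equiv.natSumNatEquivNat (Sum.inl n)) :=
      continuous_pi fun n => continuous_apply _
    have hce : c = (fun f n => f (Equiv.natSumNatEquivNat (Sum.inl n))) ∘ e := by
      ext x n
      exact (hel x n).symm
    rw [hc.eq_induced, hce, ← induced_compose]
    exact induced_mono (continuous_iff_le_induced.1 hg)
  have hqo : ∀ n, IsOpen[.induced e inferInstance] {q n} := by
    intro n
    refine isOpen_induced_iff.2 ⟨(fun f => f (Equiv.natSumNatEquivNat (Sum.inr n))) ⁻¹' {true},
      (isOpen_discrete _).preimage (continuous_apply _), ?_⟩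
    ext x
    rw [mem_preimage, mem_preimage, her]
    simp [membershipCode]
  have := hc.t2Space
  have hcyl : ∀ n x, (∀ m, x ≠ q m) → IsOpen (cylinderSet e n x) := by
    intro n x hx
    have : cylinderSet e n x = ⋂ k ∈ Finset.range n, {y | e y k = e x k} := by
      ext y; simp [cylinderSet]
    rw [this]
    refine isOpen_biInter_finset fun k _ => ?_
    obtain ⟨i, rfl⟩ := Equiv.natSumNatEquivNat.surjective k
    rcases i with i | i
    · simp_rw [hel]
      exact (isOpen_discrete {c x i}).preimage ((continuous_apply i).comp hc.continuous)
    · simp_rw [her, membershipCode_eq_iff, mem_singleton_iff, hx i, iff_false]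
      exact isOpen_compl_singleton
  have he : @Topology.IsEmbedding X _ (.induced e inferInstance) _ e :=
    hinj.isEmbedding_induced
  refine ⟨_, hle, e, he, q 0, hqo 0, fun O hO ⟨x, hx⟩ => ?_⟩
  suffices ∃ m, q m ∈ O from this.elim fun m hm => ⟨q m, hm, hqo m⟩
  by_cases hxq : ∃ m, x = q m
  · obtain ⟨m, rfl⟩ := hxq
    exact ⟨m, hx⟩
  obtain ⟨n, hn⟩ := exists_cylinderSet_subset_of_isOpen_induced hO hx
  obtain ⟨m, hm⟩ := hq.exists_mem_open (hcyl n x (not_exists.1 hxq))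
    ⟨x, mem_cylinderSet_self e n x⟩
  exact ⟨m, hn hm⟩

theorem IsLambdaSpace.exists_isCDH [t : TopologicalSpace X] [Uncountable X]
    (h : IsLambdaSpace X) : ∃ (Y : Type _) (_ : TopologicalSpace Y), SeparableSpace Y ∧
      MetrizableSpace Y ∧ IsCDH Y ∧ IsMeagre (univ : Set Y) ∧ Cardinal.mk Y = Cardinal.mk X := by
  obtain ⟨hz, hs, hm, hGδ⟩ := h
  have : SecondCountableTopology X := by
    let := metrizableSpaceMetric X
    exact UniformSpace.secondCountable_of_separable X
  obtain ⟨c, hc⟩ := hz.exists_isEmbedding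
  obtain ⟨t', hle, e, he, z₀, h₀, hiso⟩ := exists_refinement hc
  have hG : ∀ A : Set X, A.Countable → @IsGδ X t' A := fun A hA => .of_le hle (hGδ A hA)
  clear hGδ hc hs hm hz
  have hcode := FinSupp.isEmbedding_code (z₀ := z₀) he
  have := hcode.t2Space
  have := hcode.secondCountableTopology
  refine ⟨FinSupp X z₀, inferInstance, inferInstance, hcode.metrizableSpace,
    FinSupp.isCDH he h₀ hiso hG, ?_, FinSupp.mk_eq z₀⟩
  exact isMeagre_univ_of_interior_singleton (FinSupp.interior_singleton hiso)
    fun A hA => FinSupp.isGδ_of_countable hG hA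

end Main

/-- For every uncountable cardinal `κ ≤ 𝔠`: there is a separable metrizable CDH space of
cardinality `κ` which is meager in itself iff there is a λ-set of cardinality `κ`. -/
theorem CDH_meager_iff_lambda_set (κ : Cardinal)
    (hκ : Cardinal.aleph0 < κ) (hκc : κ ≤ Cardinal.continuum) :
    (∃ (X : Type) (t : TopologicalSpace X), @SeparableSpace X t ∧ @MetrizableSpace X t ∧
        @IsCDH X t ∧ @IsMeagre X t Set.univ ∧ Cardinal.mk X = κ) ↔
    (∃ (X : Type) (t : TopologicalSpace X), @IsLambdaSpace X t ∧ Cardinal.mk X = κ) := by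
  constructor
  · rintro ⟨X, t, hs, hm, hX, hmeagre, rfl⟩
    have : SecondCountableTopology X := by
      let := metrizableSpaceMetric X
      exact UniformSpace.secondCountable_of_separable X
    obtain ⟨t', ht'⟩ := exists_isLambdaSpace fun A hA => hX.isGδ_of_countable hmeagre hA
    exact ⟨X, t', ht', rfl⟩
  · rintro ⟨X, t, hX, rfl⟩
    have : Uncountable X := Cardinal.aleph0_lt_mk_iff.1 hκ
    exact hX.exists_isCDH
end
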